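/- Let G be a 2-connected claw-o-heavy graph of order n. If for every induced path v1v2v3v4v5v6 on 6 vertices in G there exist i ∈ {1,2,3} and j ∈ {4,5,6} such that d(v_i) + d(v_j) ≥ n, then G is hamiltonian. -/

import Mathlib

/-- A graph is 2-connected if it has at least 3 vertices and deleting any
single vertex leaves a connected graph. -/
def TwoConnected {V : Type*} [Fintype V] (G : SimpleGraph V) : Prop :=
  3 ≤ Fintype.card V ∧ ∀ v : V, (G.induce ({v}ᶜ : Set V)).Connected

/-- A graph `G` of order `n` is claw-o-heavy if every induced copy of the claw `K_{1,3}`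
(with center `a` and leaves `b₁, b₂, b₃`) contains two nonadjacent vertices whose
degree sum in `G` is at least `n`. -/
def ClawOHeavy {V : Type*} [Fintype V] (G : SimpleGraph V) [DecidableRel G.Adj] : Prop :=
  ∀ a b₁ b₂ b₃ : V, b₁ ≠ b₂ → b₁ ≠ b₃ → b₂ ≠ b₃ →
    G.Adj a b₁ → G.Adj a b₂ → G.Adj a b₃ →
    ¬ G.Adj b₁ b₂ → ¬ G.Adj b₁ b₃ → ¬ G.Adj b₂ b₃ →
    ∃ u v : V, u ∈ ({a, b₁, b₂, b₃} : Set V) ∧ v ∈ ({a, b₁, b₂, b₃} : Set V) ∧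
      u ≠ v ∧ ¬ G.Adj u v ∧ Fintype.card V ≤ G.degree u + G.degree v

/-- `v 0, v 1, …, v 5` is an induced path on 6 vertices in `G`. -/
def IsInducedP6 {V : Type*} (G : SimpleGraph V) (v : Fin 6 → V) : Prop :=
  Function.Injective v ∧
    ∀ i j : Fin 6, G.Adj (v i) (v j) ↔ (i.val + 1 = j.val ∨ j.val + 1 = i.val)

/-- `l` is a nonempty list with first element `a` and last element `b` in which consecutive
elements are `R`-related. -/
def RPath {V : Type*} (R : V → V → Prop) (a b : V) (l : List V) : Prop :=
  l.IsChain R ∧ l.head? = some a ∧ l.getLast? = some b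

/-- `l` is a possibly empty list that connects `a` to `b` through `R`-related neighbours. -/
def RLink {V : Type*} (R : V → V → Prop) (a : V) (l : List V) (b : V) : Prop :=
  (a :: (l ++ [b])).IsChain R

section Paths

variable {V : Type*} {R S : V → V → Prop} {a b c d : V} {l m : List V}

theorem RPath.singleton (R : V → V → Prop) (a : V) : RPath R a a [a] := by
  simp [RPath]

theorem RPath.ne_nil (h : RPath R a b l) : l ≠ [] := by
  rintro rfl
  simp [RPath] at h

theorem RPath.head_mem (h : RPath R a b l) : a ∈ l := List.mem_of_mem_head? h.2.1

theorem RPath.last_mem (h : RPath R a b l) : b ∈ l := List.mem_of_mem_getLast? h.2.2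

theorem RPath.mono (hRS : ∀ x y, R x y → S x y) (h : RPath R a b l) : RPath S a b l :=
  ⟨h.1.imp hRS, h.2⟩

theorem RPath.append (h : RPath R a b l) (hbc : R b c) (h' : RPath R c d m) :
    RPath R a d (l ++ m) := by
  obtain ⟨h1, h2, h3⟩ := h
  obtain ⟨h4, h5, h6⟩ := h'
  refine ⟨List.isChain_append.2 ⟨h1, h4, ?_⟩, by simp [h2], by simp [h6]⟩
  simp_all

theorem RPath.cons (hab : R a b) (h : RPath R b c l) : RPath R a c (a :: l) :=
  (RPath.singleton R a).append hab h

theorem RPath.concat (h : RPath R a b l) (hbc : R b c) : RPath R a c (l ++ [c]) :=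
  h.append hbc (RPath.singleton R c)

theorem RPath.reverse (hR : ∀ x y, R x y → R y x) (h : RPath R a b l) :
    RPath R b a l.reverse := by
  obtain ⟨h1, h2, h3⟩ := h
  exact ⟨List.isChain_reverse.2 (h1.imp fun x y => hR x y), by simp [h3], by simp [h2]⟩

theorem RPath.exists_cons (h : RPath R a b l) : ∃ m, l = a :: m := by
  obtain ⟨-, h2, -⟩ := h
  cases l <;> simp_all

theorem RPath.eq_of_cons (h : RPath R a b (c :: l)) : a = c := by
  have := h.2.1
  simp_all

theorem RPath.split (h : RPath R a b (l ++ m)) (hl : l ≠ []) (hm : m ≠ []) :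
    ∃ x y, RPath R a x l ∧ R x y ∧ RPath R y b m := by
  obtain ⟨h1, h2, h3⟩ := h
  obtain ⟨h4, h5, h6⟩ := List.isChain_append.1 h1
  rw [List.head?_append_of_ne_nil _ hl] at h2
  rw [List.getLast?_append_of_ne_nil _ hm] at h3
  refine ⟨l.getLast hl, m.head hm, ⟨h4, h2, List.getLast?_eq_some_getLast hl⟩, ?_,
    ⟨h5, List.head?_eq_some_head hm, h3⟩⟩
  exact h6 _ (List.getLast?_eq_some_getLast hl) _ (List.head?_eq_some_head hm)

theorem RLink.eq_or_exists (h : RLink R a l b) :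
    (l = [] ∧ R a b) ∨ ∃ x y, R a x ∧ RPath R x y l ∧ R y b := by
  rcases eq_or_ne l [] with rfl | hl
  · left
    simpa [RLink] using h
  · right
    have h0 : RPath R a b ([a] ++ (l ++ [b])) := ⟨h, by simp, by simp [List.getLast?_cons]⟩
    obtain ⟨x, y, h1, h2, h3⟩ := h0.split (by simp) (by simp)
    obtain ⟨z, w, h4, h5, h6⟩ := h3.split hl (by simp)
    obtain rfl := h6.eq_of_cons
    have := h1.2.2
    simp only [List.getLast?_singleton, Option.some.injEq] at this
    subst this
    exact ⟨y, z, h2, h4, h5⟩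

theorem RLink.nil (h : R a b) : RLink R a [] b := by simpa [RLink] using h

theorem RLink.of_rpath (ha : R a b) (h : RPath R b c l) (hd : R c d) : RLink R a l d :=
  ((h.concat hd).cons ha).1

theorem RLink.reverse (hR : ∀ x y, R x y → R y x) (h : RLink R a l b) :
    RLink R b l.reverse a := by
  rcases h.eq_or_exists with ⟨rfl, h'⟩ | ⟨x, y, h1, h2, h3⟩
  · exact RLink.nil (hR _ _ h')
  · exact RLink.of_rpath (hR _ _ h3) (h2.reverse hR) (hR _ _ h1)

theorem RPath.link (h : RPath R a b l) {k : List V} (hk : RLink R b k c) (h' : RPath R c d m) :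
    RPath R a d (l ++ (k ++ m)) := by
  rcases hk.eq_or_exists with ⟨rfl, h1⟩ | ⟨x, y, h1, h2, h3⟩
  · exact h.append h1 h'
  · exact h.append h1 (h2.append h3 h')

/-- Pairwise related elements, all related to both ends, form a link. -/
theorem RLink.of_pairwise (hl : l.Pairwise R) (ha : ∀ x ∈ l, R a x) (hb : ∀ x ∈ l, R x b)
    (hab : R a b) : RLink R a l b := by
  refine List.Pairwise.isChain (List.pairwise_cons.2 ⟨?_, List.pairwise_append.2 ⟨hl, by simp, ?_⟩⟩)
  · intro x hx
    rcases List.mem_append.1 hx with hx | hx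
    · exact ha x hx
    · obtain rfl := List.mem_singleton.1 hx
      exact hab
  · intro x hx y hy
    obtain rfl := List.mem_singleton.1 hy
    exact hb x hx

end Paths

/-- A nonempty list whose cyclically consecutive elements are `R`-related. -/
def RCycle {V : Type*} (R : V → V → Prop) (l : List V) : Prop :=
  ∃ a b, RPath R a b l ∧ R b a

/-- Adjacent in `G`, or of degree sum at least the order of `G`. -/
def OAdj {V : Type*} [Fintype V] (G : SimpleGraph V) [DecidableRel G.Adj] (u v : V) : Prop :=
  G.Adj u v ∨ Fintype.card V ≤ G.degree u + G.degree v

/-- The number of consecutive pairs of a list that are not edges of `G`. -/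
def gapCount {V : Type*} (G : SimpleGraph V) [DecidableRel G.Adj] : List V → ℕ
  | a :: b :: l => (if G.Adj a b then 0 else 1) + gapCount G (b :: l)
  | _ => 0

section MaximumCycle

variable {V : Type*} {R : V → V → Prop}

theorem RCycle.swap_append {l m : List V} (h : RCycle R (l ++ m)) : RCycle R (m ++ l) := by
  rcases eq_or_ne l [] with rfl | hl
  · simpa using h
  rcases eq_or_ne m [] with rfl | hm
  · simpa using h
  obtain ⟨a, b, h1, h2⟩ := h
  obtain ⟨x, y, h3, h4, h5⟩ := h1.split hl hm
  exact ⟨y, x, h5.append h2 h3, h4⟩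

theorem RCycle.isRotated {l m : List V} (h : RCycle R l) (hlm : l ~r m) : RCycle R m := by
  obtain ⟨k, rfl⟩ := hlm
  rw [← List.rotate_mod]
  rcases eq_or_ne l [] with rfl | hl
  · simpa using h
  rw [List.rotate_eq_drop_append_take (Nat.mod_lt _ (List.length_pos_of_ne_nil hl)).le]
  exact RCycle.swap_append (by simpa using h)

theorem RCycle.reverse (hR : ∀ x y, R x y → R y x) {l : List V} (h : RCycle R l) :
    RCycle R l.reverse := by
  obtain ⟨a, b, h1, h2⟩ := h
  exact ⟨b, a, h1.reverse hR, hR _ _ h2⟩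

end MaximumCycle

section Gaps

variable {V : Type*} [Fintype V] {G : SimpleGraph V} [DecidableRel G.Adj]

theorem OAdj.symm (u v : V) (h : OAdj G u v) : OAdj G v u := by
  unfold OAdj at *
  rwa [G.adj_comm, add_comm]

theorem OAdj.of_adj (u v : V) (h : G.Adj u v) : OAdj G u v := Or.inl h

end Gaps

section Gaps

variable {V : Type*} {G : SimpleGraph V} [DecidableRel G.Adj]

theorem gapCount_cons_cons (a b : V) (l : List V) :
    gapCount G (a :: b :: l) = (if G.Adj a b then 0 else 1) + gapCount G (b :: l) := rfl

theorem gapCount_append (X Y : List V) (x : V) :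
    gapCount G (X ++ x :: Y) = gapCount G (X ++ [x]) + gapCount G (x :: Y) := by
  induction X with
  | nil => simp [gapCount]
  | cons a X ih => cases X <;> simp_all [gapCount, add_assoc]

theorem gapCount_reverse (l : List V) : gapCount G l.reverse = gapCount G l := by
  induction l with
  | nil => rfl
  | cons a l ih =>
    cases l with
    | nil => rfl
    | cons b l =>
      rw [List.reverse_cons, List.reverse_cons, List.append_assoc, List.singleton_append,
        gapCount_append, ← List.reverse_cons, ih]
      simp [gapCount, G.adj_comm a b, add_comm]

theorem isChain_of_gapCount_eq_zero {l : List V} (h : gapCount G l = 0) : l.IsChain G.Adj := by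
  induction l with
  | nil => simp
  | cons a l ih => cases l <;> simp_all [gapCount]

theorem exists_gap {l : List V} (h : gapCount G l ≠ 0) :
    ∃ X x y Y, l = X ++ x :: y :: Y ∧ ¬ G.Adj x y := by
  induction l with
  | nil => simp [gapCount] at h
  | cons a l ih =>
    cases l with
    | nil => simp [gapCount] at h
    | cons b l =>
      by_cases hab : G.Adj a b
      · obtain ⟨X, x, y, Y, h1, h2⟩ := ih (by simpa [gapCount, hab] using h)
        exact ⟨a :: X, x, y, Y, by simp [h1], h2⟩
      · exact ⟨[], a, b, l, rfl, hab⟩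

theorem List.exists_consecutive {α : Type*} (p q : α → Prop) [DecidablePred p] [DecidablePred q]
    {l : List α} (hl : l ≠ []) (h : l.length ≤ l.dropLast.countP p + l.tail.countP q) :
    ∃ X x y Y, l = X ++ x :: y :: Y ∧ p x ∧ q y := by
  induction l with
  | nil => simp at hl
  | cons a l ih =>
    cases l with
    | nil => simp at h
    | cons b l =>
      by_cases hab : p a ∧ q b
      · exact ⟨[], a, b, l, rfl, hab⟩
      · have : (b :: l).length ≤ (b :: l).dropLast.countP p + (b :: l).tail.countP q := by
          simp only [List.dropLast_cons_cons, List.countP_cons, List.tail_cons, List.length_cons,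
            decide_eq_true_eq] at h ⊢
          split_ifs at h <;> first | omega | tauto
        obtain ⟨X, x, y, Y, h1, h2⟩ := ih (by simp) this
        exact ⟨a :: X, x, y, Y, by simp [h1], h2⟩

theorem degree_eq_countP_add [Fintype V] [DecidableEq V] {l : List V} (hl : l.Nodup) (u : V) :
    G.degree u = l.countP (G.Adj u) + (G.neighborFinset u \ l.toFinset).card := by
  have : l.countP (G.Adj u) = (G.neighborFinset u ∩ l.toFinset).card := by
    rw [List.countP_eq_length_filter, ← List.toFinset_card_of_nodup (hl.filter _)]
    congr 1
    ext x
    simp [and_comm]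
  rw [this, ← G.card_neighborFinset_eq_degree]
  exact (Finset.card_inter_add_card_sdiff _ _).symm

/-- Either a heavy nonadjacent pair of ends of a path has a common neighbour outside the path,
or the ends can be exchanged for two edges. -/
theorem exists_crossing [Fintype V] [DecidableEq V] {u v : V} {l : List V} (hl : l.Nodup)
    (hu : l.head? = some u) (hv : l.getLast? = some v)
    (h : Fintype.card V ≤ G.degree u + G.degree v) :
    (∃ w, w ∉ l ∧ G.Adj u w ∧ G.Adj v w) ∨
      ∃ X x y Y, l = X ++ x :: y :: Y ∧ G.Adj v x ∧ G.Adj u y := by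
  by_cases hw : ∃ w, w ∉ l ∧ G.Adj u w ∧ G.Adj v w
  · exact Or.inl hw
  right
  have hne : l ≠ [] := by rintro rfl; simp at hu
  refine List.exists_consecutive (G.Adj v) (G.Adj u) hne ?_
  have h1 : l.countP (G.Adj u) = l.tail.countP (G.Adj u) := by
    obtain ⟨m, rfl⟩ : ∃ m, l = u :: m := by cases l <;> simp_all
    simp
  have h2 : l.countP (G.Adj v) = l.dropLast.countP (G.Adj v) := by
    obtain ⟨m, rfl⟩ : ∃ m, l = m ++ [v] := List.getLast?_eq_some_iff.1 hv
    simp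
  have h3 : (G.neighborFinset u \ l.toFinset).card + (G.neighborFinset v \ l.toFinset).card +
      l.length ≤ Fintype.card V := by
    rw [← List.toFinset_card_of_nodup hl, ← Finset.card_union_of_disjoint,
      ← Finset.card_union_of_disjoint]
    · exact Finset.card_le_univ _
    · rw [Finset.disjoint_left]
      simp only [Finset.mem_union, Finset.mem_sdiff]
      tauto
    · rw [Finset.disjoint_left]
      intro w h4 h5
      simp only [Finset.mem_sdiff, SimpleGraph.mem_neighborFinset, List.mem_toFinset] at h4 h5
      exact hw ⟨w, h4.2, h4.1, h5.1⟩
  have h4 := degree_eq_countP_add (G := G) hl u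
  have h5 := degree_eq_countP_add (G := G) hl v
  omega

/-- A longest cycle in the relation `OAdj G` can be chosen to be a cycle of `G`. -/
theorem exists_maximum_cycle [Fintype V] [DecidableEq V] [Nonempty V]
    (hpos : ∃ l : List V, l.Nodup ∧ RCycle (OAdj G) l) :
    ∃ C : List V, C.Nodup ∧ RCycle G.Adj C ∧
      ∀ l : List V, l.Nodup → RCycle (OAdj G) l → l.length ≤ C.length := by
  classical
  let P : ℕ → Prop := fun k => ∃ l : List V, l.Nodup ∧ RCycle (OAdj G) l ∧ l.length = k
  obtain ⟨l₀, hl₀, hc₀⟩ := hpos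
  have hbound : ∀ l : List V, l.Nodup → l.length ≤ Fintype.card V := fun l hl =>
    hl.length_le_card
  have hP : P (Nat.findGreatest P (Fintype.card V)) :=
    Nat.findGreatest_spec (hbound l₀ hl₀) ⟨l₀, hl₀, hc₀, rfl⟩
  have hmax : ∀ l : List V, l.Nodup → RCycle (OAdj G) l →
      l.length ≤ Nat.findGreatest P (Fintype.card V) := fun l hl hc =>
    Nat.le_findGreatest (hbound l hl) ⟨l, hl, hc, rfl⟩
  generalize Nat.findGreatest P (Fintype.card V) = N at hP hmax
  let Q : ℕ → Prop := fun k => ∃ a b l, l.Nodup ∧ l.length = N ∧ RPath (OAdj G) a b l ∧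
    OAdj G b a ∧ gapCount G l + (if G.Adj b a then 0 else 1) = k
  have hQ : ∃ k, Q k := by
    obtain ⟨l, h1, ⟨a, b, h2, h3⟩, h4⟩ := hP
    exact ⟨_, a, b, l, h1, h4, h2, h3, rfl⟩
  have hmin := fun k => Nat.find_min' hQ (m := k)
  obtain ⟨a, b, l, h1, h2, h3, h4, h5⟩ := Nat.find_spec hQ
  rcases Nat.eq_zero_or_pos (Nat.find hQ) with h0 | h0
  · rw [h0] at h5
    have hba : G.Adj b a := by
      by_contra hba
      simp [hba] at h5
    refine ⟨l, h1, ⟨a, b, ⟨isChain_of_gapCount_eq_zero (by omega), h3.2⟩, hba⟩, ?_⟩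
    rw [h2]
    exact hmax
  exfalso
  obtain ⟨a, b, l, h1, h2, h3, h4, h5, h6⟩ : ∃ a b l, l.Nodup ∧ l.length = N ∧
      RPath (OAdj G) a b l ∧ OAdj G b a ∧ gapCount G l + 1 = Nat.find hQ ∧ ¬ G.Adj b a := by
    by_cases hba : G.Adj b a
    · obtain ⟨X, x, y, Y, rfl, hxy⟩ := exists_gap (G := G) (l := l) (by simp [hba] at h5; omega)
      have h3' : RPath (OAdj G) a b ((X ++ [x]) ++ (y :: Y)) := by simpa using h3
      obtain ⟨x', y', h6, h7, h8⟩ := h3'.split (by simp) (by simp)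
      obtain rfl := h8.eq_of_cons
      obtain rfl : x' = x := by simpa using h6.2.2.symm
      refine ⟨y', x', (y' :: Y) ++ (X ++ [x']), ?_, ?_, h8.append h4 h6, h7, ?_, hxy⟩
      · exact (List.perm_append_comm.nodup_iff).1 (by simpa using h1)
      · rw [← h2]; simp; omega
      · obtain ⟨m, hm⟩ : ∃ m, X ++ [x'] = a :: m := h6.exists_cons
        obtain ⟨k, hk⟩ : ∃ k, y' :: Y = k ++ [b] := by
          rw [← List.getLast?_eq_some_iff]; exact h8.2.2
        rw [← h5, gapCount_append X, hm, hk]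
        simp only [List.append_assoc, List.singleton_append]
        rw [gapCount_append k, ← hk]
        simp only [gapCount, if_pos hba, if_neg hxy]
        omega
    · exact ⟨a, b, l, h1, h2, h3, h4, by simpa [hba] using h5, hba⟩
  have hheavy : Fintype.card V ≤ G.degree a + G.degree b := by
    rcases h4 with h4 | h4
    · exact absurd h4 h6
    · omega
  rcases exists_crossing h1 h3.2.1 h3.2.2 hheavy with ⟨w, hw, hwa, hwb⟩ | ⟨X, x, y, Y, rfl, hx, hy⟩
  · have := hmax (l ++ [w]) (by rw [List.nodup_append]; simp [h1]; rintro c hc rfl; exact hw hc)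
      ⟨a, w, h3.concat (Or.inl hwb), Or.inl hwa.symm⟩
    simp at this
    omega
  · have h3' : RPath (OAdj G) a b ((X ++ [x]) ++ (y :: Y)) := by simpa using h3
    obtain ⟨x', y', h7, h8, h9⟩ := h3'.split (by simp) (by simp)
    obtain rfl := h9.eq_of_cons
    obtain rfl : x' = x := by simpa using h7.2.2.symm
    have := hmin _ ⟨a, y', (X ++ [x']) ++ (y' :: Y).reverse, ?_, ?_,
      h7.append (Or.inl hx.symm) (h9.reverse OAdj.symm), Or.inl hy.symm, rfl⟩
    · obtain ⟨k, hk⟩ : ∃ k, y' :: Y = k ++ [b] := by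
        rw [← List.getLast?_eq_some_iff]; exact h9.2.2
      rw [← h5, gapCount_append X (y' :: Y), hk] at this
      simp only [List.reverse_append, List.reverse_singleton, List.append_assoc,
        List.singleton_append] at this
      rw [gapCount_append X (b :: k.reverse), gapCount_cons_cons x' b, if_pos hx.symm,
        if_pos hy.symm, ← hk, gapCount_cons_cons x'] at this
      have h10 := gapCount_reverse (G := G) (y' :: Y)
      rw [hk] at h10
      simp only [List.reverse_append, List.reverse_singleton, List.singleton_append] at h10
      rw [← hk] at h10
      omega
    · refine (List.Perm.nodup_iff ?_).1 h1
      simpa using ((List.reverse_perm (y' :: Y)).symm.append_left (X ++ [x']))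
    · rw [← h2]; simp

end Gaps

theorem isHamiltonian_of_cycle {V : Type*} {G : SimpleGraph V} [Fintype V] [DecidableEq V]
    {C : List V} (hC : C.Nodup) (hcyc : RCycle G.Adj C) (hlen : C.length = Fintype.card V)
    (h3 : 3 ≤ Fintype.card V) : G.IsHamiltonian := by
  obtain ⟨a, b, h1, h2⟩ := hcyc
  intro _
  have hsup := SimpleGraph.Walk.support_ofSupport h1.ne_nil h1.1
  have hlen' := SimpleGraph.Walk.length_ofSupport h1.ne_nil h1.1
  have ha : C.head h1.ne_nil = a := by
    have := h1.2.1
    rw [List.head?_eq_some_head h1.ne_nil] at this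
    simpa using this
  have hb : C.getLast h1.ne_nil = b := by
    have := h1.2.2
    rw [List.getLast?_eq_some_getLast h1.ne_nil] at this
    simpa using this
  have h2' : G.Adj (C.getLast h1.ne_nil) (C.head h1.ne_nil) := by rwa [ha, hb]
  refine ⟨_, SimpleGraph.Walk.cons h2' (SimpleGraph.Walk.ofSupport C h1.ne_nil h1.1), ?_⟩
  rw [SimpleGraph.Walk.isHamiltonianCycle_iff_isCycle_and_length_eq,
    SimpleGraph.Walk.isCycle_iff_isPath_tail_and_le_length]
  have : (SimpleGraph.Walk.cons h2' (SimpleGraph.Walk.ofSupport C h1.ne_nil h1.1)).length =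
      Fintype.card V := by
    rw [SimpleGraph.Walk.length_cons, hlen']
    omega
  refine ⟨⟨?_, by omega⟩, this⟩
  rw [SimpleGraph.Walk.isPath_def]
  simp [hsup, hC]

/-- A cycle of `G` that is a longest cycle in the relation `OAdj G`. -/
structure MaxCycle {V : Type*} [Fintype V] (G : SimpleGraph V) [DecidableRel G.Adj]
    (C : List V) : Prop where
  nodup : C.Nodup
  cycle : RCycle G.Adj C
  length_le : ∀ l : List V, l.Nodup → RCycle (OAdj G) l → l.length ≤ C.length

/-- Among any three distinct neighbours of a vertex, two are related by `OAdj G`. -/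
def ClawOAdj {V : Type*} [Fintype V] (G : SimpleGraph V) [DecidableRel G.Adj] : Prop :=
  ∀ a x y z : V, G.Adj a x → G.Adj a y → G.Adj a z → x ≠ y → x ≠ z → y ≠ z →
    OAdj G x y ∨ OAdj G x z ∨ OAdj G y z

theorem ClawOHeavy.clawOAdj {V : Type*} [Fintype V] {G : SimpleGraph V} [DecidableRel G.Adj]
    (h : ClawOHeavy G) : ClawOAdj G := by
  intro a x y z hx hy hz hxy hxz hyz
  by_contra! hne
  obtain ⟨h1, h2, h3⟩ := hne
  have hnot : ∀ u v, ¬ OAdj G u v → ¬ G.Adj u v ∧ ¬ G.Adj v u ∧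
      ¬ Fintype.card V ≤ G.degree u + G.degree v ∧
      ¬ Fintype.card V ≤ G.degree v + G.degree u := by
    intro u v huv
    rw [G.adj_comm v u, add_comm (G.degree v)]
    unfold OAdj at huv
    tauto
  have h4 := hnot _ _ h1
  have h5 := hnot _ _ h2
  have h6 := hnot _ _ h3
  obtain ⟨u, v, hu, hv, huv, hadj, hdeg⟩ := h a x y z hxy hxz hyz hx hy hz h4.1 h5.1 h6.1
  simp only [Set.mem_insert_iff, Set.mem_singleton_iff] at hu hv
  rcases hu with rfl | rfl | rfl | rfl <;> rcases hv with rfl | rfl | rfl | rfl <;>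
    simp_all [G.adj_comm]

/-- A cycle `s, Q₁, t, Q₂` together with a path `π` outside of it that connects `s` to `t`.
The paths `Q₁`, `Q₂`, `π` run from `s₁` to `t₁`, from `t₂` to `s₂` and from `p` to `q`. -/
structure Theta {V : Type*} [Fintype V] (G : SimpleGraph V) [DecidableRel G.Adj]
    (C : List V) (s t : V) (Q₁ Q₂ π : List V) (s₁ t₁ t₂ s₂ p q : V) : Prop where
  max : MaxCycle G C
  rot : C ~r s :: (Q₁ ++ t :: Q₂)
  path₁ : RPath G.Adj s₁ t₁ Q₁
  path₂ : RPath G.Adj t₂ s₂ Q₂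
  adj_s₁ : G.Adj s s₁
  adj_t₁ : G.Adj t₁ t
  adj_t₂ : G.Adj t t₂
  adj_s₂ : G.Adj s₂ s
  path : RPath (OAdj G) p q π
  path_nodup : π.Nodup
  notMem : ∀ x ∈ π, x ∉ C
  oadj_s : OAdj G s p
  oadj_t : OAdj G q t

section Theta

variable {V : Type*} [Fintype V] {G : SimpleGraph V} [DecidableRel G.Adj] {C : List V}

theorem MaxCycle.reverse (h : MaxCycle G C) : MaxCycle G C.reverse where
  nodup := List.nodup_reverse.2 h.nodup
  cycle := h.cycle.reverse fun _ _ h => h.symm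
  length_le := by simpa using h.length_le

theorem MaxCycle.false_of_perm (h : MaxCycle G C) {l π D : List V} {a b : V} (hD : C.Perm D)
    (hne : π ≠ []) (hnodup : π.Nodup) (hout : ∀ x ∈ π, x ∉ C) (hl : RPath (OAdj G) a b l)
    (hba : OAdj G b a) (hp : l.Perm (π ++ D)) : False := by
  have h1 : l.Perm (π ++ C) := hp.trans (hD.symm.append_left π)
  have h2 : l.Nodup := by
    rw [h1.nodup_iff, List.nodup_append]
    refine ⟨hnodup, h.nodup, ?_⟩
    rintro x hx y hy rfl
    exact hout x hx hy
  have h3 := h.length_le l h2 ⟨a, b, hl, hba⟩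
  rw [h1.length_eq, List.length_append] at h3
  have := List.length_pos_of_ne_nil hne
  omega

theorem MaxCycle.exists_rotation (h : MaxCycle G C) {s : V} (hs : s ∈ C) :
    ∃ D, C ~r s :: D ∧ RCycle G.Adj (s :: D) := by
  obtain ⟨X, Y, rfl⟩ := List.append_of_mem hs
  have : X ++ s :: Y ~r s :: (Y ++ X) := by
    have := List.isRotated_append (l := X) (l' := s :: Y)
    simpa using this
  exact ⟨Y ++ X, this, h.cycle.isRotated this⟩

/-- Inserting an outside path right after `s`. -/
theorem MaxCycle.not_oadj_of_insertion (h : MaxCycle G C) {s s₁ s₂ x o : V} {D ω : List V}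
    (hrot : C ~r s :: D) (hD : RPath G.Adj s₁ s₂ D) (hs₂ : G.Adj s₂ s)
    (hω : RPath (OAdj G) x o ω) (hnodup : ω.Nodup) (hout : ∀ y ∈ ω, y ∉ C)
    (hx : OAdj G s x) : ¬ OAdj G o s₁ := by
  intro ho
  refine h.false_of_perm hrot.perm hω.ne_nil hnodup hout
    (hω.append ho ((hD.mono OAdj.of_adj).concat (Or.inl hs₂))) hx ?_
  exact (List.perm_append_singleton s D).append_left ω

theorem MaxCycle.exists_theta (h : MaxCycle G C) {s t p q : V} {π : List V} (hs : s ∈ C)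
    (ht : t ∈ C) (hst : s ≠ t) (hπ : RPath (OAdj G) p q π) (hnodup : π.Nodup)
    (hout : ∀ x ∈ π, x ∉ C) (hsp : OAdj G s p) (hqt : OAdj G q t) :
    ∃ Q₁ Q₂ s₁ t₁ t₂ s₂, Theta G C s t Q₁ Q₂ π s₁ t₁ t₂ s₂ p q := by
  obtain ⟨D, hrot, a, b, hp, hba⟩ := h.exists_rotation hs
  obtain rfl := hp.eq_of_cons
  have htD : t ∈ D := by
    have := hrot.perm.mem_iff.1 ht
    simp only [List.mem_cons] at this
    tauto
  obtain ⟨X, Y, rfl⟩ := List.append_of_mem htD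
  have hπr := hπ.reverse OAdj.symm
  have hX : X ≠ [] := by
    rintro rfl
    have h1 := hp.split (l := [a]) (m := t :: Y) (by simp) (by simp)
    obtain ⟨x, y, h1, h2, h3⟩ := h1
    obtain rfl := h3.eq_of_cons
    exact h.not_oadj_of_insertion hrot h3 hba hπ hnodup hout hsp hqt
  have h0 : RPath G.Adj a b ([a] ++ (X ++ t :: Y)) := hp
  obtain ⟨x, y, h1, h2, h3⟩ := h0.split (by simp) (by simp)
  obtain rfl : x = a := by simpa using h1.2.2.symm
  have hY : Y ≠ [] := by
    rintro rfl
    obtain rfl : t = b := by simpa [List.getLast?_cons] using hp.2.2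
    have h4 : x :: (X ++ [t]) ~r t :: x :: X := by
      have := List.isRotated_append (l := x :: X) (l' := [t])
      simpa using this
    obtain ⟨u, v, h5, h6, h7⟩ := h3.split hX (by simp)
    obtain rfl := h7.eq_of_cons
    refine h.not_oadj_of_insertion (hrot.trans h4) (h5.cons h2) h6 hπr
      (List.nodup_reverse.2 hnodup) (by simpa using hout) (OAdj.symm _ _ hqt) (OAdj.symm _ _ hsp)
  obtain ⟨u, v, h4, h5, h6⟩ := h3.split hX (by simp)
  obtain rfl := h6.eq_of_cons
  have h6' : RPath G.Adj v b ([v] ++ Y) := h6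
  obtain ⟨z, w, h7, h8, h9⟩ := h6'.split (by simp) hY
  obtain rfl : z = v := by simpa using h7.2.2.symm
  exact ⟨X, Y, y, u, w, b, h, hrot, h4, h9, h2, h5, h8, hba, hπ, hnodup, hout, hsp, hqt⟩

namespace Theta

variable {s t s₁ t₁ t₂ s₂ p q : V} {Q₁ Q₂ π : List V}

theorem swap (T : Theta G C s t Q₁ Q₂ π s₁ t₁ t₂ s₂ p q) :
    Theta G C t s Q₂ Q₁ π.reverse t₂ s₂ s₁ t₁ q p where
  max := T.max
  rot := T.rot.trans (by
    have := List.isRotated_append (l := s :: Q₁) (l' := t :: Q₂)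
    simpa using this)
  path₁ := T.path₂
  path₂ := T.path₁
  adj_s₁ := T.adj_t₂
  adj_t₁ := T.adj_s₂
  adj_t₂ := T.adj_s₁
  adj_s₂ := T.adj_t₁
  path := T.path.reverse OAdj.symm
  path_nodup := List.nodup_reverse.2 T.path_nodup
  notMem := by simpa using T.notMem
  oadj_s := OAdj.symm _ _ T.oadj_t
  oadj_t := OAdj.symm _ _ T.oadj_s

theorem rev (T : Theta G C s t Q₁ Q₂ π s₁ t₁ t₂ s₂ p q) :
    Theta G C.reverse s t Q₂.reverse Q₁.reverse π s₂ t₂ t₁ s₁ p q where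
  max := T.max.reverse
  rot := T.rot.reverse.trans (by
    have := List.isRotated_append (l := Q₂.reverse ++ t :: Q₁.reverse) (l' := [s])
    simpa using this)
  path₁ := T.path₂.reverse fun _ _ h => h.symm
  path₂ := T.path₁.reverse fun _ _ h => h.symm
  adj_s₁ := T.adj_s₂.symm
  adj_t₁ := T.adj_t₂.symm
  adj_t₂ := T.adj_t₁.symm
  adj_s₂ := T.adj_s₁.symm
  path := T.path
  path_nodup := T.path_nodup
  notMem := by simpa using T.notMem
  oadj_s := T.oadj_s
  oadj_t := T.oadj_t

theorem nodup (T : Theta G C s t Q₁ Q₂ π s₁ t₁ t₂ s₂ p q) :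
    (s :: (Q₁ ++ t :: Q₂)).Nodup := T.rot.nodup_iff.1 T.max.nodup

theorem mem_iff (T : Theta G C s t Q₁ Q₂ π s₁ t₁ t₂ s₂ p q) {x : V} :
    x ∈ C ↔ x = s ∨ x ∈ Q₁ ∨ x = t ∨ x ∈ Q₂ := by
  rw [T.rot.mem_iff]
  simp

theorem s_mem (T : Theta G C s t Q₁ Q₂ π s₁ t₁ t₂ s₂ p q) : s ∈ C := by simp [T.mem_iff]

theorem t_mem (T : Theta G C s t Q₁ Q₂ π s₁ t₁ t₂ s₂ p q) : t ∈ C := by simp [T.mem_iff]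

theorem s₁_mem (T : Theta G C s t Q₁ Q₂ π s₁ t₁ t₂ s₂ p q) : s₁ ∈ C := by
  simp [T.mem_iff, T.path₁.head_mem]

theorem s₂_mem (T : Theta G C s t Q₁ Q₂ π s₁ t₁ t₂ s₂ p q) : s₂ ∈ C := by
  simp [T.mem_iff, T.path₂.last_mem]

theorem p_notMem (T : Theta G C s t Q₁ Q₂ π s₁ t₁ t₂ s₂ p q) : p ∉ C :=
  T.notMem p T.path.head_mem

theorem ne_of_mem₁_of_mem₂ (T : Theta G C s t Q₁ Q₂ π s₁ t₁ t₂ s₂ p q) {x y : V}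
    (hx : x ∈ Q₁) (hy : y ∈ Q₂) : x ≠ y := by
  have := T.nodup
  rintro rfl
  simp only [List.nodup_cons, List.nodup_append, List.mem_cons] at this
  exact this.2.2.2 x hx x (Or.inr hy) rfl

theorem s₁_ne_s₂ (T : Theta G C s t Q₁ Q₂ π s₁ t₁ t₂ s₂ p q) : s₁ ≠ s₂ :=
  T.ne_of_mem₁_of_mem₂ T.path₁.head_mem T.path₂.last_mem

theorem false_of_perm (T : Theta G C s t Q₁ Q₂ π s₁ t₁ t₂ s₂ p q) {l : List V} {a b : V}
    (hl : RPath (OAdj G) a b l) (hba : OAdj G b a)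
    (hp : l.Perm (π ++ s :: (Q₁ ++ t :: Q₂))) : False :=
  T.max.false_of_perm T.rot.perm T.path.ne_nil T.path_nodup T.notMem hl hba hp

theorem opath₁ (T : Theta G C s t Q₁ Q₂ π s₁ t₁ t₂ s₂ p q) : RPath (OAdj G) s₁ t₁ Q₁ :=
  T.path₁.mono OAdj.of_adj

theorem opath₂ (T : Theta G C s t Q₁ Q₂ π s₁ t₁ t₂ s₂ p q) : RPath (OAdj G) t₂ s₂ Q₂ :=
  T.path₂.mono OAdj.of_adj

theorem not_oadj_s₁ (T : Theta G C s t Q₁ Q₂ π s₁ t₁ t₂ s₂ p q) {x o : V} {ω : List V}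
    (hω : RPath (OAdj G) x o ω) (hnodup : ω.Nodup) (hout : ∀ y ∈ ω, y ∉ C)
    (hx : OAdj G s x) : ¬ OAdj G o s₁ :=
  T.max.not_oadj_of_insertion T.rot (T.path₁.append T.adj_t₁ (T.path₂.cons T.adj_t₂)) T.adj_s₂
    hω hnodup hout hx

theorem not_oadj_s₁_of_notMem (T : Theta G C s t Q₁ Q₂ π s₁ t₁ t₂ s₂ p q) {o : V}
    (ho : o ∉ C) (hs : OAdj G s o) : ¬ OAdj G o s₁ :=
  T.not_oadj_s₁ (RPath.singleton _ o) (by simp) (by simpa using ho) hs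

theorem not_oadj_p_s₁ (T : Theta G C s t Q₁ Q₂ π s₁ t₁ t₂ s₂ p q) : ¬ OAdj G p s₁ :=
  T.not_oadj_s₁_of_notMem T.p_notMem T.oadj_s

theorem oadj_s₂_s₁ (T : Theta G C s t Q₁ Q₂ π s₁ t₁ t₂ s₂ p q) (hcl : ClawOAdj G)
    (hsp : G.Adj s p) : OAdj G s₂ s₁ := by
  rcases hcl s p s₁ s₂ hsp T.adj_s₁ T.adj_s₂.symm (fun h => T.p_notMem (h ▸ T.s₁_mem))
    (fun h => T.p_notMem (h ▸ T.s₂_mem)) T.s₁_ne_s₂ with h | h | h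
  · exact absurd h T.not_oadj_p_s₁
  · exact absurd h T.rev.not_oadj_p_s₁
  · exact OAdj.symm _ _ h

theorem not_oadj_s_t₁ (T : Theta G C s t Q₁ Q₂ π s₁ t₁ t₂ s₂ p q) (h : OAdj G s₂ s₁) :
    ¬ OAdj G s t₁ := fun hs => by
  classical
  refine T.false_of_perm ((((T.opath₁.reverse OAdj.symm).append (OAdj.symm _ _ h)
    (T.opath₂.reverse OAdj.symm)).append (Or.inl T.adj_t₂.symm)
    ((T.path.reverse OAdj.symm).cons (OAdj.symm _ _ T.oadj_t))).concat
    (OAdj.symm _ _ T.oadj_s)) hs ?_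
  grind

theorem not_oadj_s_t₂ (T : Theta G C s t Q₁ Q₂ π s₁ t₁ t₂ s₂ p q) (h : OAdj G s₂ s₁) :
    ¬ OAdj G s t₂ :=
  T.rev.not_oadj_s_t₁ (OAdj.symm _ _ h)

/-- If `s` and `t` are adjacent, the two cycle neighbours of `t` are related as well. -/
theorem oadj_t₁_t₂_of_adj (T : Theta G C s t Q₁ Q₂ π s₁ t₁ t₂ s₂ p q) (hcl : ClawOAdj G)
    (h : OAdj G s₂ s₁) (hst : G.Adj s t) : OAdj G t₁ t₂ := by
  have h1 : t₁ ≠ s := by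
    rintro rfl
    have := T.nodup
    simp [T.path₁.last_mem] at this
  have h2 : t₂ ≠ s := by
    rintro rfl
    have := T.nodup
    simp [T.path₂.head_mem] at this
  rcases hcl t t₁ t₂ s T.adj_t₁.symm T.adj_t₂ hst.symm T.swap.s₁_ne_s₂.symm h1 h2 with h3 | h3 | h3
  · exact h3
  · exact absurd (OAdj.symm _ _ h3) (T.not_oadj_s_t₁ h)
  · exact absurd (OAdj.symm _ _ h3) (T.not_oadj_s_t₂ h)

theorem oadj_t₁_t₂ (T : Theta G C s t Q₁ Q₂ π s₁ t₁ t₂ s₂ p q) (hcl : ClawOAdj G)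
    (hqt : G.Adj q t) : OAdj G t₁ t₂ := T.swap.oadj_s₂_s₁ hcl hqt.symm

theorem ne_p_of_mem (T : Theta G C s t Q₁ Q₂ π s₁ t₁ t₂ s₂ p q) {x : V} (hx : x ∈ C) : p ≠ x :=
  fun h => T.p_notMem (h ▸ hx)

theorem ne_s_of_mem₁ (T : Theta G C s t Q₁ Q₂ π s₁ t₁ t₂ s₂ p q) {x : V} (hx : x ∈ Q₁) :
    x ≠ s := by
  rintro rfl
  have := T.nodup
  simp [hx] at this

theorem oadj_of_not_oadj_p (T : Theta G C s t Q₁ Q₂ π s₁ t₁ t₂ s₂ p q) (hcl : ClawOAdj G)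
    (hsp : G.Adj s p) {c d : V} (hc : c ∈ C) (hsc : G.Adj s c) (hcp : ¬ OAdj G c p)
    (hd : d ∈ C) (hsd : G.Adj s d) (hdp : ¬ OAdj G d p) (hcd : c ≠ d) : OAdj G c d := by
  rcases hcl s p c d hsp hsc hsd (T.ne_p_of_mem hc) (T.ne_p_of_mem hd) hcd with h | h | h
  · exact absurd (OAdj.symm _ _ h) hcp
  · exact absurd (OAdj.symm _ _ h) hdp
  · exact h

theorem oadj_s₁_of_not_oadj_p (T : Theta G C s t Q₁ Q₂ π s₁ t₁ t₂ s₂ p q) (hcl : ClawOAdj G)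
    (hsp : G.Adj s p) {c : V} (hc : c ∈ C) (hsc : G.Adj s c) (hcp : ¬ OAdj G c p)
    (hne : c ≠ s₁) : OAdj G c s₁ :=
  T.oadj_of_not_oadj_p hcl hsp hc hsc hcp T.s₁_mem T.adj_s₁
    (fun h => T.not_oadj_p_s₁ (OAdj.symm _ _ h)) hne

theorem t₁_mem (T : Theta G C s t Q₁ Q₂ π s₁ t₁ t₂ s₂ p q) : t₁ ∈ C := T.swap.s₂_mem

theorem t₂_mem (T : Theta G C s t Q₁ Q₂ π s₁ t₁ t₂ s₂ p q) : t₂ ∈ C := T.swap.s₁_mem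

theorem t₁_ne_s (T : Theta G C s t Q₁ Q₂ π s₁ t₁ t₂ s₂ p q) : t₁ ≠ s :=
  T.ne_s_of_mem₁ T.path₁.last_mem

theorem t₂_ne_s (T : Theta G C s t Q₁ Q₂ π s₁ t₁ t₂ s₂ p q) : t₂ ≠ s :=
  T.rev.ne_s_of_mem₁ (List.mem_reverse.2 T.path₂.head_mem)

theorem t₁_ne_t₂ (T : Theta G C s t Q₁ Q₂ π s₁ t₁ t₂ s₂ p q) : t₁ ≠ t₂ := T.swap.s₁_ne_s₂.symm

end Theta

end Theta

section Neighbours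

variable {V : Type*} [Fintype V] [DecidableEq V] {G : SimpleGraph V} [DecidableRel G.Adj]
  {C : List V}

namespace Theta

variable {s t s₁ t₁ t₂ s₂ p q : V} {Q₁ Q₂ π : List V}

theorem succ_s (T : Theta G C s t Q₁ Q₂ π s₁ t₁ t₂ s₂ p q) : C.formPerm s = s₁ := by
  rw [List.formPerm_eq_of_isRotated T.max.nodup T.rot]
  obtain ⟨m, hm⟩ := T.path₁.exists_cons
  have := T.nodup
  rw [hm] at this ⊢
  exact List.formPerm_apply_head _ _ _ this

theorem pred_s (T : Theta G C s t Q₁ Q₂ π s₁ t₁ t₂ s₂ p q) : C.formPerm⁻¹ s = s₂ := by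
  rw [← List.formPerm_reverse]
  exact T.rev.succ_s

theorem succ_t (T : Theta G C s t Q₁ Q₂ π s₁ t₁ t₂ s₂ p q) : C.formPerm t = t₂ := T.swap.succ_s

theorem pred_t (T : Theta G C s t Q₁ Q₂ π s₁ t₁ t₂ s₂ p q) : C.formPerm⁻¹ t = t₁ := T.swap.pred_s

end Theta

/-- A chord `s c` whose ends both see the outside vertex `p`. -/
theorem MaxCycle.hook (h : MaxCycle G C) (hcl : ClawOAdj G) {s c p : V} (hs : s ∈ C)
    (hc : c ∈ C) (hsc : G.Adj s c) (hp : p ∉ C) (hsp : G.Adj s p) (hcp : OAdj G c p) :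
    OAdj G (C.formPerm⁻¹ c) (C.formPerm c) ∧ ¬ OAdj G s (C.formPerm c) ∧
      ¬ OAdj G s (C.formPerm⁻¹ c) ∧ ¬ OAdj G c (C.formPerm s) ∧ ¬ OAdj G c (C.formPerm⁻¹ s) := by
  obtain ⟨Q₁, Q₂, s₁, t₁, t₂, s₂, T⟩ := h.exists_theta hs hc hsc.ne (RPath.singleton _ p)
    (by simp) (by simpa using hp) (Or.inl hsp) (OAdj.symm _ _ hcp)
  rw [T.succ_s, T.pred_s, T.succ_t, T.pred_t]
  have h1 := T.oadj_s₂_s₁ hcl hsp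
  have h2 := T.oadj_t₁_t₂_of_adj hcl h1 hsc
  exact ⟨h2, T.not_oadj_s_t₂ h1, T.not_oadj_s_t₁ h1, T.swap.not_oadj_s_t₂ h2,
    T.swap.not_oadj_s_t₁ h2⟩

namespace Theta

variable {s t s₁ t₁ t₂ s₂ p q : V} {Q₁ Q₂ π : List V}

theorem not_oadj_t_of_mem₁ (T : Theta G C s t Q₁ Q₂ π s₁ t₁ t₂ s₂ p q) (hcl : ClawOAdj G)
    (hsp : G.Adj s p) (hqt : G.Adj q t) {c : V} (hc : c ∈ Q₁) (hsc : G.Adj s c)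
    (hcp : ¬ OAdj G c p) : ¬ OAdj G c t := by
  intro hct
  have hs := T.oadj_s₂_s₁ hcl hsp
  have ht := T.oadj_t₁_t₂ hcl hqt
  have hcC : c ∈ C := by simp [T.mem_iff, hc]
  have h1 := T.swap.not_oadj_s_t₂ ht
  have h2 := T.not_oadj_s_t₁ hs
  have hne : c ≠ s₁ := by rintro rfl; exact h1 (OAdj.symm _ _ hct)
  have hcs₁ := T.oadj_s₁_of_not_oadj_p hcl hsp hcC hsc hcp hne
  obtain ⟨X, Y, rfl⟩ := List.append_of_mem hc
  have hX : X ≠ [] := by rintro rfl; exact hne T.path₁.eq_of_cons.symm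
  have hY : Y ≠ [] := by
    rintro rfl
    have := T.path₁.2.2
    simp only [List.getLast?_append, List.getLast?_singleton, Option.some_or,
      Option.some.injEq] at this
    subst this
    exact h2 (Or.inl hsc)
  obtain ⟨u, w, h3, h4, h5⟩ := T.path₁.split hX (by simp)
  obtain rfl := h5.eq_of_cons
  have h5' : RPath G.Adj w t₁ ([w] ++ Y) := h5
  obtain ⟨z, v, h6, h7, h8⟩ := h5'.split (by simp) hY
  obtain rfl : z = w := by simpa using h6.2.2.symm
  have hu : u ≠ s := T.ne_s_of_mem₁ (by simp [h3.last_mem])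
  have hv : v ≠ s := T.ne_s_of_mem₁ (by simp [h8.head_mem])
  have huv : u ≠ v := by
    rintro rfl
    have := T.nodup
    simp only [List.nodup_cons, List.nodup_append, List.mem_cons] at this
    exact this.2.1.2.2 u h3.last_mem u (Or.inr h8.head_mem) rfl
  have hX' := h3.mono OAdj.of_adj
  have hY' := h8.mono OAdj.of_adj
  have hsπ := T.path.cons T.oadj_s
  rcases hcl z u v s h4.symm h7 hsc.symm huv hu hv with h | h | h
  · refine T.false_of_perm (((((hsπ.concat T.oadj_t).concat (OAdj.symm _ _ hct)).append hcs₁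
      (hX'.append h hY')).append ht T.opath₂)) (Or.inl T.adj_s₂) ?_
    grind
  · refine T.false_of_perm ((((((hY'.cons (OAdj.of_adj _ _ h7)).cons (OAdj.symm _ _ hct)).append ht
      T.opath₂).append hs hX').append h hsπ)) T.oadj_t ?_
    grind
  · refine T.false_of_perm ((((((hX'.reverse OAdj.symm).cons (OAdj.of_adj _ _ h4.symm)).cons
      (OAdj.symm _ _ hct)).append (OAdj.symm _ _ hs) (T.opath₂.reverse OAdj.symm)).append
      (OAdj.symm _ _ ht) (hY'.reverse OAdj.symm)).append h hsπ) T.oadj_t ?_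
    grind

theorem not_oadj_t_of_not_oadj_p (T : Theta G C s t Q₁ Q₂ π s₁ t₁ t₂ s₂ p q) (hcl : ClawOAdj G)
    (hsp : G.Adj s p) (hqt : G.Adj q t) {c : V} (hc : c ∈ C) (hct : c ≠ t) (hsc : G.Adj s c)
    (hcp : ¬ OAdj G c p) : ¬ OAdj G c t := by
  rcases T.mem_iff.1 hc with rfl | h | rfl | h
  · exact absurd hsc (G.irrefl)
  · exact T.not_oadj_t_of_mem₁ hcl hsp hqt h hsc hcp
  · exact absurd rfl hct
  · exact T.rev.not_oadj_t_of_mem₁ hcl hsp hqt (List.mem_reverse.2 h) hsc hcp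

theorem not_oadj_s₁_of_oadj_p (T : Theta G C s t Q₁ Q₂ π s₁ t₁ t₂ s₂ p q) (hcl : ClawOAdj G)
    (hsp : G.Adj s p) {c : V} (hsc : G.Adj s c) (hc : c ∈ C → OAdj G c p) : ¬ OAdj G c s₁ := by
  by_cases h : c ∈ C
  · rw [← T.succ_s]
    exact (T.max.hook hcl T.s_mem h hsc T.p_notMem hsp (hc h)).2.2.2.1
  · exact T.not_oadj_s₁_of_notMem h (Or.inl hsc)

theorem oadj_of_oadj_p (T : Theta G C s t Q₁ Q₂ π s₁ t₁ t₂ s₂ p q) (hcl : ClawOAdj G)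
    (hsp : G.Adj s p) {c d : V} (hsc : G.Adj s c) (hc : c ∈ C → OAdj G c p)
    (hsd : G.Adj s d) (hd : d ∈ C → OAdj G d p) (hcd : c ≠ d) : OAdj G c d := by
  have hne : ∀ x, (x ∈ C → OAdj G x p) → x ≠ s₁ := by
    rintro x hx rfl
    exact T.not_oadj_p_s₁ (OAdj.symm _ _ (hx T.s₁_mem))
  rcases hcl s s₁ c d T.adj_s₁ hsc hsd (hne c hc).symm (hne d hd).symm hcd with h | h | h
  · exact absurd (OAdj.symm _ _ h) (T.not_oadj_s₁_of_oadj_p hcl hsp hsc hc)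
  · exact absurd (OAdj.symm _ _ h) (T.not_oadj_s₁_of_oadj_p hcl hsp hsd hd)
  · exact h

end Theta

end Neighbours

theorem List.exists_first_failure {α : Type*} (P : α → Prop) {l : List α} {a b : α}
    (ha : l.head? = some a) (hb : l.getLast? = some b) (hPa : P a) (hPb : ¬ P b) :
    ∃ X x y Y, l = X ++ x :: y :: Y ∧ (∀ z ∈ X, P z) ∧ P x ∧ ¬ P y := by
  induction l generalizing a with
  | nil => simp at ha
  | cons c l ih =>
    obtain rfl : c = a := by simpa using ha
    cases l with
    | nil =>
      obtain rfl : c = b := by simpa using hb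
      exact absurd hPa hPb
    | cons d l =>
      by_cases hd : P d
      · obtain ⟨X, x, y, Y, h1, h2, h3⟩ := ih (a := d) rfl (by simpa using hb) hd
        exact ⟨c :: X, x, y, Y, by simp [h1], by simpa using ⟨hPa, h2⟩, h3⟩
      · exact ⟨[], c, d, l, rfl, by simp, hPa, hd⟩

/-- A theta configuration in which `α, a` and `γ, b` are the maximal initial segments of the two
paths of the cycle that consist of neighbours of `s` and of `t`, respectively. -/
structure Runs {V : Type*} [Fintype V] (G : SimpleGraph V) [DecidableRel G.Adj]
    (C : List V) (s t : V) (α : List V) (a y : V) (β γ : List V) (b z : V) (δ π : List V)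
    (s₁ t₁ t₂ s₂ p q : V) : Prop where
  theta : Theta G C s t (α ++ a :: y :: β) (γ ++ b :: z :: δ) π s₁ t₁ t₂ s₂ p q
  claw : ClawOAdj G
  adj_p : G.Adj s p
  adj_q : G.Adj q t
  adj_run_s : ∀ x ∈ α, G.Adj s x
  adj_a : G.Adj s a
  not_adj_y : ¬ G.Adj s y
  adj_run_t : ∀ x ∈ γ, G.Adj t x
  adj_b : G.Adj t b
  not_adj_z : ¬ G.Adj t z

section Runs

variable {V : Type*} [Fintype V] {G : SimpleGraph V} [DecidableRel G.Adj]
  {C : List V}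

theorem Theta.exists_runs {s t s₁ t₁ t₂ s₂ p q : V} {Q₁ Q₂ π : List V}
    (T : Theta G C s t Q₁ Q₂ π s₁ t₁ t₂ s₂ p q) (hcl : ClawOAdj G) (hsp : G.Adj s p)
    (hqt : G.Adj q t) : ∃ α a y β γ b z δ, Runs G C s t α a y β γ b z δ π s₁ t₁ t₂ s₂ p q := by
  have h1 := T.not_oadj_s_t₁ (T.oadj_s₂_s₁ hcl hsp)
  have h2 := T.swap.not_oadj_s_t₁ (T.oadj_t₁_t₂ hcl hqt)
  obtain ⟨α, a, y, β, rfl, h3, h4, h5⟩ := List.exists_first_failure (G.Adj s) T.path₁.2.1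
    T.path₁.2.2 T.adj_s₁ fun h => h1 (Or.inl h)
  obtain ⟨γ, b, z, δ, rfl, h6, h7, h8⟩ := List.exists_first_failure (G.Adj t) T.path₂.2.1
    T.path₂.2.2 T.adj_t₂ fun h => h2 (Or.inl h)
  exact ⟨α, a, y, β, γ, b, z, δ, T, hcl, hsp, hqt, h3, h4, h5, h6, h7, h8⟩

namespace Runs

variable {s t a y b z s₁ t₁ t₂ s₂ p q : V} {α β γ δ π : List V}

theorem swap (S : Runs G C s t α a y β γ b z δ π s₁ t₁ t₂ s₂ p q) :
    Runs G C t s γ b z δ α a y β π.reverse t₂ s₂ s₁ t₁ q p where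
  theta := S.theta.swap
  claw := S.claw
  adj_p := S.adj_q.symm
  adj_q := S.adj_p.symm
  adj_run_s := S.adj_run_t
  adj_a := S.adj_b
  not_adj_y := S.not_adj_z
  adj_run_t := S.adj_run_s
  adj_b := S.adj_a
  not_adj_z := S.not_adj_y

theorem path_y (S : Runs G C s t α a y β γ b z δ π s₁ t₁ t₂ s₂ p q) :
    RPath (OAdj G) y t₁ (y :: β) ∧ G.Adj a y := by
  have h := S.theta.path₁
  rw [List.append_cons] at h
  obtain ⟨u, v, h1, h2, h3⟩ := h.split (by simp) (by simp)
  obtain rfl := h3.eq_of_cons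
  obtain rfl : u = a := by simpa using h1.2.2.symm
  exact ⟨h3.mono OAdj.of_adj, h2⟩

theorem false_of_prefix (S : Runs G C s t α a y β γ b z δ π s₁ t₁ t₂ s₂ p q) {o w c d : V}
    {ω l : List V} (hω : RPath (OAdj G) o w ω) (hnodup : ω.Nodup) (hout : ∀ x ∈ ω, x ∉ C)
    (hl : RPath (OAdj G) c d l) (hdo : OAdj G d o) (hwc : OAdj G w c)
    (hp : l.Perm (s :: (α ++ a :: y :: β ++ t :: (γ ++ b :: z :: δ)))) : False :=
  S.theta.max.false_of_perm S.theta.rot.perm hω.ne_nil hnodup hout (hl.append hdo hω) hwc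
    ((hp.append_right ω).trans List.perm_append_comm)

end Runs

variable [DecidableEq V]

theorem MaxCycle.formPerm_eq (h : MaxCycle G C) {X Y : List V} {u v : V}
    (hrot : C ~r X ++ u :: v :: Y) : C.formPerm u = v := by
  have h1 : C ~r u :: v :: (Y ++ X) := hrot.trans (by
    have := List.isRotated_append (l := X) (l' := u :: v :: Y)
    simpa using this)
  rw [List.formPerm_eq_of_isRotated h.nodup h1]
  exact List.formPerm_apply_head _ _ _ (h1.nodup_iff.1 h.nodup)

theorem Theta.not_oadj_p_of_run {s t s₁ t₁ t₂ s₂ p q : V} {X Y Q₂ π : List V}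
    (T : Theta G C s t (X ++ Y) Q₂ π s₁ t₁ t₂ s₂ p q) (hcl : ClawOAdj G)
    (hsp : G.Adj s p) (hX : ∀ x ∈ X, G.Adj s x) : ∀ x ∈ X, ¬ OAdj G x p := by
  intro x hx hxp
  obtain ⟨Z, W, rfl⟩ := List.append_of_mem hx
  rcases List.eq_nil_or_concat Z with rfl | ⟨Z, u, rfl⟩
  · obtain rfl := T.path₁.eq_of_cons
    exact T.not_oadj_p_s₁ (OAdj.symm _ _ hxp)
  · have h1 : C.formPerm u = x := T.max.formPerm_eq (X := s :: Z) (Y := W ++ Y ++ t :: Q₂)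
      (by simpa using T.rot)
    have h2 := T.max.hook hcl T.s_mem (by simp [T.mem_iff]) (hX x hx) T.p_notMem hsp hxp
    rw [← h1] at h2
    simp only [Equiv.Perm.inv_def, Equiv.symm_apply_apply] at h2
    exact h2.2.2.1 (Or.inl (hX u (by simp)))

namespace Runs

variable {s t a y b z s₁ t₁ t₂ s₂ p q : V} {α β γ δ π : List V}

theorem not_oadj_p (S : Runs G C s t α a y β γ b z δ π s₁ t₁ t₂ s₂ p q) :
    ∀ x ∈ α ++ [a], ¬ OAdj G x p := by
  have T := S.theta
  rw [List.append_cons] at T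
  refine T.not_oadj_p_of_run S.claw S.adj_p ?_
  simpa [or_imp, forall_and] using ⟨S.adj_run_s, S.adj_a⟩

theorem link_s (S : Runs G C s t α a y β γ b z δ π s₁ t₁ t₂ s₂ p q) :
    RLink (OAdj G) s₂ α s ∧ RLink (OAdj G) s₂ α a := by
  have T := S.theta
  have hmem : ∀ x ∈ α ++ [a], x ∈ C := by
    intro x hx
    rw [T.mem_iff, List.append_cons, List.mem_append]
    exact Or.inr (Or.inl (Or.inl hx))
  have hadj : ∀ x ∈ α ++ [a], G.Adj s x := by
    simpa [or_imp, forall_and] using ⟨S.adj_run_s, S.adj_a⟩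
  have hnodup : (α ++ [a]).Nodup := by
    have := (List.nodup_append.1 (List.nodup_cons.1 T.nodup).2).1
    rw [List.append_cons] at this
    exact (List.nodup_append.1 this).1
  have hpair : (α ++ [a]).Pairwise (OAdj G) :=
    hnodup.imp_of_mem fun {x w} hx hw hxw => T.oadj_of_not_oadj_p S.claw S.adj_p (hmem x hx)
      (hadj x hx) (S.not_oadj_p x hx) (hmem w hw) (hadj w hw) (S.not_oadj_p w hw) hxw
  have hs₂ : ∀ x ∈ α ++ [a], OAdj G s₂ x := fun x hx =>
    OAdj.symm _ _ (T.rev.oadj_s₁_of_not_oadj_p S.claw S.adj_p (List.mem_reverse.2 (hmem x hx))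
      (hadj x hx) (S.not_oadj_p x hx) (T.ne_of_mem₁_of_mem₂ (by
        rw [List.append_cons]
        exact List.mem_append_left _ hx) T.path₂.last_mem))
  have h1 := List.pairwise_append.1 hpair
  have h2 : ∀ x ∈ α, OAdj G s₂ x := fun x hx => hs₂ x (by simp [hx])
  exact ⟨RLink.of_pairwise h1.1 h2 (fun x hx => Or.inl (S.adj_run_s x hx).symm)
      (Or.inl T.adj_s₂),
    RLink.of_pairwise h1.1 h2 (fun x hx => h1.2.2 x hx a (by simp)) (hs₂ a (by simp))⟩

theorem not_oadj_y_t (S : Runs G C s t α a y β γ b z δ π s₁ t₁ t₂ s₂ p q) : ¬ OAdj G y t := by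
  intro h
  have T := S.theta
  have h1 := T.oadj_t₁_t₂ S.claw S.adj_q
  refine T.false_of_perm ((S.path_y.1.append h1 T.opath₂).link S.link_s.2
    (((T.path.concat T.oadj_t).cons T.oadj_s).cons (OAdj.of_adj _ _ S.adj_a.symm)))
    (OAdj.symm _ _ h) ?_
  grind

theorem not_oadj_a_t (S : Runs G C s t α a y β γ b z δ π s₁ t₁ t₂ s₂ p q) : ¬ OAdj G a t := by
  intro h
  have T := S.theta
  have h1 := T.oadj_t₁_t₂ S.claw S.adj_q
  refine T.false_of_perm (((S.path_y.1.cons (OAdj.of_adj _ _ S.path_y.2)).append h1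
    T.opath₂).link S.link_s.1 ((T.path.concat T.oadj_t).cons T.oadj_s)) (OAdj.symm _ _ h) ?_
  grind

theorem not_oadj_y_b (S : Runs G C s t α a y β γ b z δ π s₁ t₁ t₂ s₂ p q) : ¬ OAdj G y b := by
  intro h
  have T := S.theta
  have h1 := ((T.path.reverse OAdj.symm).concat (OAdj.symm _ _ T.oadj_s)).cons
    (OAdj.symm _ _ T.oadj_t)
  have h2 := (((S.swap.path_y.1.reverse OAdj.symm).concat
    (OAdj.of_adj _ _ S.swap.path_y.2.symm)).append (OAdj.symm _ _ h) S.path_y.1).link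
    S.swap.link_s.1 h1
  refine T.false_of_perm ((RPath.singleton _ a).link (S.link_s.2.reverse OAdj.symm) h2)
    (Or.inl S.adj_a) ?_
  grind

theorem not_oadj_y_z (S : Runs G C s t α a y β γ b z δ π s₁ t₁ t₂ s₂ p q) : ¬ OAdj G y z := by
  intro h
  have T := S.theta
  refine T.false_of_perm ((S.swap.path_y.1.link S.link_s.2
    ((((T.path.concat T.oadj_t).concat (OAdj.of_adj _ _ S.adj_b)).cons T.oadj_s).cons
      (OAdj.of_adj _ _ S.adj_a.symm))).link (S.swap.link_s.2.reverse OAdj.symm)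
    (S.path_y.1.reverse OAdj.symm)) h ?_
  grind

theorem not_oadj_a_b (S : Runs G C s t α a y β γ b z δ π s₁ t₁ t₂ s₂ p q) : ¬ OAdj G a b := by
  intro h
  have T := S.theta
  refine T.false_of_perm (((S.swap.path_y.1.cons (OAdj.of_adj _ _ S.swap.path_y.2)).link S.link_s.1
    ((T.path.concat T.oadj_t).cons T.oadj_s)).link (S.swap.link_s.1.reverse OAdj.symm)
    ((S.path_y.1.reverse OAdj.symm).concat (OAdj.of_adj _ _ S.path_y.2.symm))) h ?_
  grind

theorem not_oadj_y_of_prefix (S : Runs G C s t α a y β γ b z δ π s₁ t₁ t₂ s₂ p q) {o w : V}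
    {ω : List V} (hω : RPath (OAdj G) o w ω) (hnodup : ω.Nodup) (hout : ∀ x ∈ ω, x ∉ C)
    (hso : OAdj G s o) : ¬ OAdj G y w := by
  intro h
  have T := S.theta
  refine S.false_of_prefix hω hnodup hout (((S.path_y.1.concat (OAdj.of_adj _ _ T.adj_t₁)).append
    (OAdj.of_adj _ _ T.adj_t₂) T.opath₂).link S.link_s.2 ((RPath.singleton _ s).cons
    (OAdj.of_adj _ _ S.adj_a.symm))) hso (OAdj.symm _ _ h) ?_
  grind

theorem not_oadj_a_of_prefix (S : Runs G C s t α a y β γ b z δ π s₁ t₁ t₂ s₂ p q) {o w : V}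
    {ω : List V} (hω : RPath (OAdj G) o w ω) (hnodup : ω.Nodup) (hout : ∀ x ∈ ω, x ∉ C)
    (hso : OAdj G s o) : ¬ OAdj G a w := by
  intro h
  have T := S.theta
  refine S.false_of_prefix hω hnodup hout ((((S.path_y.1.cons (OAdj.of_adj _ _ S.path_y.2)).concat
    (OAdj.of_adj _ _ T.adj_t₁)).append (OAdj.of_adj _ _ T.adj_t₂) T.opath₂).link S.link_s.1
    (RPath.singleton _ s)) hso (OAdj.symm _ _ h) ?_
  grind

end Runs

end Runs

section Counting

variable {V : Type*} [Fintype V] {G : SimpleGraph V} [DecidableRel G.Adj]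
  {C : List V}

theorem RPath.exists_append_link {V : Type*} {R : V → V → Prop} {a b c : V} {l k : List V}
    (h : RPath R a b l) (hk : RLink R b k c) : ∃ d, RPath R a d (l ++ k) ∧ R d c := by
  rcases hk.eq_or_exists with ⟨rfl, h1⟩ | ⟨x, y, h1, h2, h3⟩
  · exact ⟨b, by simpa using h, h1⟩
  · exact ⟨y, h.append h1 h2, h3⟩

theorem List.Nodup.exists_perm_append {V : Type*} {l : List V} (hl : l.Nodup) (P : V → Prop) :
    ∃ A B : List V, (A ++ B).Perm l ∧ A.Nodup ∧ B.Nodup ∧ (∀ x ∈ A, x ∈ l ∧ P x) ∧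
      ∀ x ∈ B, x ∈ l ∧ ¬ P x := by
  classical
  refine ⟨l.filter P, l.filter fun x => ¬ P x, ?_, hl.filter _, hl.filter _, by simp, by simp⟩
  simpa using List.filter_append_perm (fun x => decide (P x)) l

namespace Theta

variable {s t s₁ t₁ t₂ s₂ p q : V} {Q₁ Q₂ π : List V}

theorem link_s_of_not_oadj_p (T : Theta G C s t Q₁ Q₂ π s₁ t₁ t₂ s₂ p q) (hcl : ClawOAdj G)
    (hsp : G.Adj s p) {l : List V} (hl : l.Nodup)
    (h : ∀ x ∈ l, x ∈ Q₂ ∧ G.Adj s x ∧ ¬ OAdj G x p) : RLink (OAdj G) s l s₁ := by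
  have hC : ∀ x ∈ l, x ∈ C := fun x hx => T.mem_iff.2 (by simp [(h x hx).1])
  refine RLink.of_pairwise (hl.imp_of_mem fun {x y} hx hy hxy => ?_)
    (fun x hx => Or.inl (h x hx).2.1) (fun x hx => ?_) (Or.inl T.adj_s₁)
  · exact T.oadj_of_not_oadj_p hcl hsp (hC x hx) (h x hx).2.1 (h x hx).2.2 (hC y hy) (h y hy).2.1
      (h y hy).2.2 hxy
  · exact T.oadj_s₁_of_not_oadj_p hcl hsp (hC x hx) (h x hx).2.1 (h x hx).2.2
      (T.ne_of_mem₁_of_mem₂ T.path₁.head_mem (h x hx).1).symm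

variable [DecidableEq V]

theorem pairwise_of_oadj_p (T : Theta G C s t Q₁ Q₂ π s₁ t₁ t₂ s₂ p q) (hcl : ClawOAdj G)
    (hsp : G.Adj s p) {l : List V} (hl : l.Nodup)
    (h : ∀ x ∈ l, G.Adj s x ∧ (x ∈ C → OAdj G x p)) : l.Pairwise (OAdj G) :=
  hl.imp_of_mem fun {x y} hx hy hxy =>
    T.oadj_of_oadj_p hcl hsp (h x hx).1 (h x hx).2 (h y hy).1 (h y hy).2 hxy

theorem oadj_p_of_adj (T : Theta G C s t Q₁ Q₂ π s₁ t₁ t₂ s₂ p q) (hcl : ClawOAdj G)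
    (hsp : G.Adj s p) {x : V} (hx : G.Adj s x) (h : x ∈ C → OAdj G x p) (hxp : x ≠ p) :
    OAdj G x p :=
  T.oadj_of_oadj_p hcl hsp hx h hsp (fun hp => absurd hp T.p_notMem) hxp

/-- If the cycle is left at `e` instead of `t`, the part `S` of the cycle that is skipped has at
least as many vertices nonadjacent to `s` and `t` as there are outside neighbours of `s`, `t`. -/
theorem card_outside_le (T : Theta G C s t Q₁ Q₂ π s₁ t₁ t₂ s₂ p q) (hcl : ClawOAdj G)
    (hsp : G.Adj s p) (hqt : G.Adj q t) {e : V} {Y S : List V} (hQ : Q₂ = Y ++ S)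
    (hY : RPath (OAdj G) t e (t :: Y)) (heq : OAdj G e q)
    (he : ∀ x, x ∉ t :: Y → G.Adj t x → (x ∈ C → OAdj G x q) → OAdj G e x) :
    (Finset.univ.filter fun x => x ∉ C ∧ (G.Adj s x ∨ G.Adj t x)).card ≤
      (S.toFinset.filter fun x => ¬ (G.Adj s x ∨ G.Adj t x)).card := by
  have hSQ : ∀ x ∈ S, x ∈ Q₂ := fun x hx => by simp [hQ, hx]
  have hSC : ∀ x ∈ S, x ∈ C := fun x hx => T.mem_iff.2 (by simp [hSQ x hx])
  set U : Finset V := Finset.univ.filter fun x =>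
    x ∉ π ∧ (x ∈ S ∨ x ∉ C) ∧ (G.Adj s x ∨ G.Adj t x) with hU
  have hUm : ∀ x, x ∈ U.toList ↔ x ∉ π ∧ (x ∈ S ∨ x ∉ C) ∧ (G.Adj s x ∨ G.Adj t x) := by
    simp [hU]
  have hUn : U.toList.Nodup := U.nodup_toList
  obtain ⟨Ut, Us, hpermU, hUtn, hUsn, hUt, hUs⟩ := hUn.exists_perm_append fun x => G.Adj t x
  obtain ⟨At, Bt, hpermT, hAtn, hBtn, hAt, hBt⟩ :=
    hUtn.exists_perm_append fun x => x ∈ C ∧ ¬ OAdj G x q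
  obtain ⟨As, Bs, hpermS, hAsn, hBsn, hAs, hBs⟩ :=
    hUsn.exists_perm_append fun x => x ∈ C ∧ ¬ OAdj G x p
  have hAtm : ∀ x ∈ At, x ∈ S ∧ G.Adj t x ∧ ¬ OAdj G x q := fun x hx => by
    have h1 := hAt x hx
    have h2 := hUt x h1.1
    have h3 := (hUm x).1 h2.1
    exact ⟨h3.2.1.resolve_right (not_not.2 h1.2.1), h2.2, h1.2.2⟩
  have hAsm : ∀ x ∈ As, x ∈ S ∧ G.Adj s x ∧ ¬ OAdj G x p := fun x hx => by
    have h1 := hAs x hx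
    have h2 := hUs x h1.1
    have h3 := (hUm x).1 h2.1
    exact ⟨h3.2.1.resolve_right (not_not.2 h1.2.1), h3.2.2.resolve_right h2.2, h1.2.2⟩
  have hBtm : ∀ x ∈ Bt, (x ∈ S ∨ x ∉ C) ∧ x ∉ π ∧ G.Adj t x ∧ (x ∈ C → OAdj G x q) :=
    fun x hx => by
      have h1 := hBt x hx
      have h2 := hUt x h1.1
      have h3 := (hUm x).1 h2.1
      exact ⟨h3.2.1, h3.1, h2.2, by simpa using h1.2⟩
  have hBsm : ∀ x ∈ Bs, x ∉ π ∧ G.Adj s x ∧ (x ∈ C → OAdj G x p) := fun x hx => by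
    have h1 := hBs x hx
    have h2 := hUs x h1.1
    have h3 := (hUm x).1 h2.1
    exact ⟨h3.1, h3.2.2.resolve_right h2.2, by simpa using h1.2⟩
  have hlinkAs : RLink (OAdj G) s As s₁ := T.link_s_of_not_oadj_p hcl hsp
    hAsn fun x hx => ⟨hSQ x (hAsm x hx).1, (hAsm x hx).2⟩
  have hlinkAt : RLink (OAdj G) t₁ At t := by
    have h1 := T.swap.rev.link_s_of_not_oadj_p hcl hqt.symm (l := At.reverse)
      (List.nodup_reverse.2 hAtn) fun x hx => by
        have := hAtm x (List.mem_reverse.1 hx)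
        exact ⟨List.mem_reverse.2 (hSQ x this.1), this.2⟩
    simpa using h1.reverse OAdj.symm
  have hlinkBt : RLink (OAdj G) e Bt q := by
    refine RLink.of_pairwise (T.swap.pairwise_of_oadj_p hcl hqt.symm hBtn
      fun x hx => (hBtm x hx).2.2) (fun x hx => ?_) (fun x hx => ?_) heq
    · have h1 := hBtm x hx
      refine he x ?_ h1.2.2.1 h1.2.2.2
      rintro h2
      rcases List.mem_cons.1 h2 with rfl | h2
      · exact G.irrefl h1.2.2.1
      rcases h1.1 with h3 | h3
      · have := (List.nodup_cons.1 (List.nodup_append.1 (List.nodup_cons.1 T.nodup).2).2.1).2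
        rw [hQ] at this
        exact (List.nodup_append.1 this).2.2 x h2 x h3 rfl
      · exact h3 (T.mem_iff.2 (by simp [hQ, h2]))
    · have h1 := hBtm x hx
      exact T.swap.oadj_p_of_adj hcl hqt.symm h1.2.2.1 h1.2.2.2
        fun h => h1.2.1 (h ▸ T.path.last_mem)
  have hlinkBs : RLink (OAdj G) p Bs s := by
    refine RLink.of_pairwise (T.pairwise_of_oadj_p hcl hsp hBsn
      fun x hx => (hBsm x hx).2) (fun x hx => ?_) (fun x hx => Or.inl (hBsm x hx).2.1.symm)
      (Or.inl hsp.symm)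
    have h1 := hBsm x hx
    exact OAdj.symm _ _ (T.oadj_p_of_adj hcl hsp h1.2.1 h1.2.2
      fun h => h1.1 (h ▸ T.path.head_mem))
  obtain ⟨d, h1, h2⟩ := ((((hY.link hlinkBt (T.path.reverse OAdj.symm)).link hlinkBs
    (RPath.singleton _ s)).link hlinkAs T.opath₁)).exists_append_link hlinkAt
  have hpart : (s :: (Q₁ ++ t :: Y)).Nodup ∧ ∀ x ∈ s :: (Q₁ ++ t :: Y), x ∈ C ∧ x ∉ S := by
    have h3 := T.nodup
    have h4 : s :: (Q₁ ++ t :: Q₂) = (s :: (Q₁ ++ t :: Y)) ++ S := by simp [hQ]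
    rw [h4, List.nodup_append] at h3
    refine ⟨h3.1, fun x hx => ⟨?_, fun hxS => h3.2.2 x hx x hxS rfl⟩⟩
    rw [T.rot.mem_iff, h4]
    exact List.mem_append_left _ hx
  have hnodup : (U.toList ++ (π ++ s :: (Q₁ ++ t :: Y))).Nodup := by
    rw [List.nodup_append, List.nodup_append]
    refine ⟨hUn, ⟨T.path_nodup, hpart.1, ?_⟩, ?_⟩
    · rintro x hx y hy rfl
      exact T.notMem x hx (hpart.2 x hy).1
    · rintro x hx y hy rfl
      have h3 := (hUm x).1 hx
      have h4 := hpart.2 x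
      rw [List.mem_append] at hy
      tauto
  have hperm : (U.toList ++ (π ++ s :: (Q₁ ++ t :: Y))).Perm
      (t :: Y ++ (Bt ++ π.reverse) ++ (Bs ++ [s]) ++ (As ++ Q₁) ++ At) := by
    refine ((hpermU.symm.trans (hpermT.symm.append hpermS.symm)).append_right _).trans ?_
    clear * -
    grind
  have hlen := T.max.length_le _ ((List.Perm.nodup_iff hperm).1 hnodup) ⟨t, d, h1, h2⟩
  have hlen' : U.card + π.length ≤ S.length := by
    have h3 := hpermU.length_eq
    have h4 := hpermT.length_eq
    have h5 := hpermS.length_eq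
    have h6 := T.rot.perm.length_eq
    simp only [List.length_append, List.length_cons, List.length_reverse, Finset.length_toList,
      List.length_nil, hQ] at hlen h3 h4 h5 h6
    omega
  have hSn : S.Nodup := by
    have := (List.nodup_cons.1 (List.nodup_append.1 (List.nodup_cons.1 T.nodup).2).2.1).2
    rw [hQ] at this
    exact (List.nodup_append.1 this).2.1
  have hcard : (S.toFinset.filter fun x => G.Adj s x ∨ G.Adj t x).card +
      (Finset.univ.filter fun x => x ∉ C ∧ (G.Adj s x ∨ G.Adj t x)).card ≤
      U.card + π.length := by
    rw [← List.toFinset_card_of_nodup T.path_nodup, ← Finset.card_union_of_disjoint]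
    · refine (Finset.card_le_card ?_).trans (Finset.card_union_le _ _)
      intro x hx
      have h3 := T.notMem x
      simp only [Finset.mem_union, Finset.mem_filter, Finset.mem_univ, true_and,
        List.mem_toFinset, hU] at hx ⊢
      tauto
    · rw [Finset.disjoint_left]
      intro x h3 h4
      simp only [Finset.mem_filter, Finset.mem_univ, true_and, List.mem_toFinset] at h3 h4
      exact h4.1 (hSC x h3.1)
  have hsplit := Finset.card_filter_add_card_filter_not (s := S.toFinset)
    (fun x => G.Adj s x ∨ G.Adj t x)
  rw [List.toFinset_card_of_nodup hSn] at hsplit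
  omega

end Theta

end Counting

section DegreeSum

variable {V : Type*} [Fintype V] [DecidableEq V] {G : SimpleGraph V} [DecidableRel G.Adj]
  {C : List V}

/-- The predecessors and successors of suitable neighbours of an outside vertex are distinct. -/
theorem MaxCycle.two_mul_card_le (h : MaxCycle G C) {p : V} (hp : p ∉ C) {X L : Finset V}
    (hX : ∀ x ∈ X, x ∈ C ∧ OAdj G x p ∧ OAdj G (C.formPerm⁻¹ x) (C.formPerm x) ∧
      C.formPerm⁻¹ x ≠ C.formPerm x ∧ C.formPerm⁻¹ x ∈ L ∧ C.formPerm x ∈ L) :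
    2 * X.card ≤ L.card := by
  have hdisj : Disjoint (X.image C.formPerm) (X.image ⇑C.formPerm⁻¹) := by
    rw [Finset.disjoint_left]
    intro y h1 h2
    obtain ⟨c, hc, rfl⟩ := Finset.mem_image.1 h1
    obtain ⟨d, hd, hdc⟩ := Finset.mem_image.1 h2
    have hne : d ≠ c := by
      rintro rfl
      exact (hX d hd).2.2.2.1 hdc
    obtain ⟨Q₁, Q₂, s₁, t₁, t₂, s₂, T⟩ := h.exists_theta (hX d hd).1 (hX c hc).1 hne
      (RPath.singleton _ p) (by simp) (by simpa using hp) (hX d hd).2.1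
      (OAdj.symm _ _ (hX c hc).2.1)
    have h3 := (hX d hd).2.2.1
    have h4 := T.adj_s₂.symm
    rw [T.pred_s, T.succ_t] at hdc
    rw [T.succ_s, T.pred_s] at h3
    exact T.not_oadj_s_t₂ h3 (hdc ▸ Or.inl h4)
  have hsub : X.image C.formPerm ∪ X.image ⇑C.formPerm⁻¹ ⊆ L := by
    intro y hy
    rcases Finset.mem_union.1 hy with hy | hy
    · obtain ⟨c, hc, rfl⟩ := Finset.mem_image.1 hy
      exact (hX c hc).2.2.2.2.2
    · obtain ⟨c, hc, rfl⟩ := Finset.mem_image.1 hy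
      exact (hX c hc).2.2.2.2.1
  have hcard := Finset.card_le_card hsub
  rw [Finset.card_union_of_disjoint hdisj, Finset.card_image_of_injective _ (Equiv.injective _),
    Finset.card_image_of_injective _ (Equiv.injective _)] at hcard
  omega

namespace Theta

variable {s t s₁ t₁ t₂ s₂ p q : V} {Q₁ Q₂ π : List V}

theorem oadj_p_of_common (T : Theta G C s t Q₁ Q₂ π s₁ t₁ t₂ s₂ p q) (hcl : ClawOAdj G)
    (hsp : G.Adj s p) (hqt : G.Adj q t) {c : V} (hc : c ∈ C) (hsc : G.Adj s c)
    (htc : G.Adj t c) : OAdj G c p := by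
  by_contra h
  exact T.not_oadj_t_of_not_oadj_p hcl hsp hqt hc htc.ne' hsc h (Or.inl htc.symm)

end Theta

theorem MaxCycle.hook_mem (h : MaxCycle G C) {s c p : V} (hs : s ∈ C) (hc : c ∈ C) (hsc : s ≠ c)
    (hp : p ∉ C) (hsp : OAdj G s p) (hcp : OAdj G c p) :
    (C.formPerm⁻¹ c ∈ C ∧ C.formPerm⁻¹ c ≠ s) ∧ (C.formPerm c ∈ C ∧ C.formPerm c ≠ s) ∧
      C.formPerm⁻¹ c ≠ C.formPerm c := by
  obtain ⟨Q₁, Q₂, s₁, t₁, t₂, s₂, T⟩ := h.exists_theta hs hc hsc (RPath.singleton _ p)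
    (by simp) (by simpa using hp) hsp (OAdj.symm _ _ hcp)
  rw [T.succ_t, T.pred_t]
  exact ⟨⟨T.t₁_mem, T.t₁_ne_s⟩, ⟨T.t₂_mem, T.t₂_ne_s⟩, T.t₁_ne_t₂⟩

variable (G C) in
/-- The vertices of the cycle other than `s`, `t` that are adjacent to neither of them. -/
def nonNeighbors (s t : V) : Finset V :=
  Finset.univ.filter fun x => (x ∈ C ∧ x ≠ s ∧ x ≠ t) ∧ ¬ (G.Adj s x ∨ G.Adj t x)

namespace Theta

variable {s t s₁ t₁ t₂ s₂ p q : V} {Q₁ Q₂ π : List V}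

theorem common_hook (T : Theta G C s t Q₁ Q₂ π s₁ t₁ t₂ s₂ p q) (hcl : ClawOAdj G)
    (hsp : G.Adj s p) (hqt : G.Adj q t) {c : V} (hc : c ∈ C) (hsc : G.Adj s c)
    (htc : G.Adj t c) :
    OAdj G c p ∧ OAdj G (C.formPerm⁻¹ c) (C.formPerm c) ∧ C.formPerm⁻¹ c ≠ C.formPerm c ∧
      C.formPerm⁻¹ c ∈ nonNeighbors G C s t ∧ C.formPerm c ∈ nonNeighbors G C s t := by
  have hcp := T.oadj_p_of_common hcl hsp hqt hc hsc htc
  have hcq := T.swap.oadj_p_of_common hcl hqt.symm hsp.symm hc htc hsc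
  have h1 := T.max.hook hcl T.s_mem hc hsc T.p_notMem hsp hcp
  have h2 := T.max.hook hcl T.t_mem hc htc T.swap.p_notMem hqt.symm hcq
  have h3 := T.max.hook_mem T.s_mem hc hsc.ne T.p_notMem T.oadj_s hcp
  have h4 := T.max.hook_mem T.t_mem hc htc.ne T.swap.p_notMem (OAdj.symm _ _ T.oadj_t) hcq
  simp only [OAdj, not_or] at h1 h2
  simp only [nonNeighbors, Finset.mem_filter, Finset.mem_univ, true_and, not_or]
  exact ⟨hcp, h1.1, h3.2.2, ⟨⟨h3.1.1, h3.1.2, h4.1.2⟩, h1.2.2.1.1, h2.2.2.1.1⟩,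
    ⟨h3.2.1.1, h3.2.1.2, h4.2.1.2⟩, h1.2.1.1, h2.2.1.1⟩

theorem two_mul_card_common_le (T : Theta G C s t Q₁ Q₂ π s₁ t₁ t₂ s₂ p q) (hcl : ClawOAdj G)
    (hsp : G.Adj s p) (hqt : G.Adj q t) :
    2 * (Finset.univ.filter fun x => x ∈ C ∧ G.Adj s x ∧ G.Adj t x).card ≤
      (nonNeighbors G C s t).card := by
  refine T.max.two_mul_card_le T.p_notMem fun x hx => ?_
  simp only [Finset.mem_filter, Finset.mem_univ, true_and] at hx
  exact ⟨hx.1, T.common_hook hcl hsp hqt hx.1 hx.2.1 hx.2.2⟩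

theorem card_outside_le_right (T : Theta G C s t Q₁ Q₂ π s₁ t₁ t₂ s₂ p q) (hcl : ClawOAdj G)
    (hsp : G.Adj s p) (hqt : G.Adj q t) :
    (Finset.univ.filter fun x => x ∉ C ∧ (G.Adj s x ∨ G.Adj t x)).card ≤
      (Q₂.toFinset.filter fun x => ¬ (G.Adj s x ∨ G.Adj t x)).card :=
  T.card_outside_le hcl hsp hqt (Y := []) rfl (RPath.singleton _ t) (OAdj.symm _ _ T.oadj_t)
    fun _ _ h _ => Or.inl h

theorem card_outside_lt_right (T : Theta G C s t Q₁ Q₂ π s₁ t₁ t₂ s₂ p q) (hcl : ClawOAdj G)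
    (hsp : G.Adj s p) (hqt : G.Adj q t) {c : V} (hc : c ∈ Q₂) (hsc : G.Adj s c)
    (htc : G.Adj t c) :
    (Finset.univ.filter fun x => x ∉ C ∧ (G.Adj s x ∨ G.Adj t x)).card <
      (Q₂.toFinset.filter fun x => ¬ (G.Adj s x ∨ G.Adj t x)).card := by
  have hcC : c ∈ C := T.mem_iff.2 (by simp [hc])
  have hcq := T.swap.oadj_p_of_common hcl hqt.symm hsp.symm hcC htc hsc
  have hL := (T.common_hook hcl hsp hqt hcC hsc htc).2.2.2.1
  obtain ⟨Y, S, rfl⟩ := List.append_of_mem hc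
  rcases List.eq_nil_or_concat Y with rfl | ⟨Z, u, rfl⟩
  · obtain rfl := T.path₂.eq_of_cons
    exact absurd (OAdj.symm _ _ hcq) T.swap.not_oadj_p_s₁
  rw [List.concat_eq_append] at *
  have hsucc : C.formPerm u = c := T.max.formPerm_eq (X := s :: (Q₁ ++ t :: Z)) (Y := S)
    (by simpa using T.rot)
  rw [Equiv.Perm.inv_eq_iff_eq.2 hsucc.symm] at hL
  have hQ : (Z ++ [u] ++ c :: S).Nodup :=
    (List.nodup_cons.1 (List.nodup_append.1 (List.nodup_cons.1 T.nodup).2).2.1).2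
  have hY : RPath (OAdj G) t c (t :: (Z ++ [u] ++ [c])) := by
    have h := T.opath₂
    obtain ⟨v, w, h1, h2, h3⟩ := h.split (by simp) (by simp)
    obtain rfl := h3.eq_of_cons
    exact (h1.concat h2).cons (OAdj.of_adj _ _ T.adj_t₂)
  have hle := T.card_outside_le hcl hsp hqt (e := c) (Y := Z ++ [u] ++ [c]) (S := S) (by simp)
    hY hcq fun x hx htx hxq => T.swap.oadj_of_oadj_p hcl hqt.symm htc (fun _ => hcq) htx hxq
      (by rintro rfl; simp at hx)
  refine hle.trans_lt (Finset.card_lt_card ?_)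
  rw [Finset.ssubset_iff_of_subset]
  · refine ⟨u, ?_, ?_⟩
    · simp only [nonNeighbors, Finset.mem_filter] at hL
      simpa using hL.2.2
    · have : u ∉ S := by
        intro hu
        exact (List.nodup_append.1 hQ).2.2 u (by simp) u (by simp [hu]) rfl
      simp [this]
  · intro x
    simp only [Finset.mem_filter, List.mem_toFinset]
    rintro ⟨h1, h2⟩
    exact ⟨by simp [h1], h2⟩

theorem card_right_add_card_left_le (T : Theta G C s t Q₁ Q₂ π s₁ t₁ t₂ s₂ p q) :
    (Q₂.toFinset.filter fun x => ¬ (G.Adj s x ∨ G.Adj t x)).card +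
      (Q₁.toFinset.filter fun x => ¬ (G.Adj s x ∨ G.Adj t x)).card ≤
      (nonNeighbors G C s t).card := by
  rw [← Finset.card_union_of_disjoint]
  · refine Finset.card_le_card fun x hx => ?_
    simp only [nonNeighbors, Finset.mem_union, Finset.mem_filter, List.mem_toFinset,
      Finset.mem_univ, true_and] at hx ⊢
    rcases hx with hx | hx
    · exact ⟨⟨T.mem_iff.2 (by simp [hx.1]), T.rev.ne_s_of_mem₁ (List.mem_reverse.2 hx.1),
        T.swap.ne_s_of_mem₁ hx.1⟩, hx.2⟩
    · exact ⟨⟨T.mem_iff.2 (by simp [hx.1]), T.ne_s_of_mem₁ hx.1,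
        T.swap.rev.ne_s_of_mem₁ (List.mem_reverse.2 hx.1)⟩, hx.2⟩
  · rw [Finset.disjoint_left]
    intro x h1 h2
    simp only [Finset.mem_filter, List.mem_toFinset] at h1 h2
    exact T.ne_of_mem₁_of_mem₂ h2.1 h1.1 rfl

theorem two_mul_card_outside_le (T : Theta G C s t Q₁ Q₂ π s₁ t₁ t₂ s₂ p q) (hcl : ClawOAdj G)
    (hsp : G.Adj s p) (hqt : G.Adj q t) :
    2 * (Finset.univ.filter fun x => x ∉ C ∧ (G.Adj s x ∨ G.Adj t x)).card ≤
      (nonNeighbors G C s t).card := by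
  have h1 := T.card_outside_le_right hcl hsp hqt
  have h2 := T.rev.card_outside_le_right hcl hsp hqt
  have h3 := T.card_right_add_card_left_le
  simp only [List.mem_reverse, List.toFinset_reverse] at h2
  omega

theorem two_mul_card_outside_lt (T : Theta G C s t Q₁ Q₂ π s₁ t₁ t₂ s₂ p q) (hcl : ClawOAdj G)
    (hsp : G.Adj s p) (hqt : G.Adj q t) {c : V} (hc : c ∈ C) (hsc : G.Adj s c)
    (htc : G.Adj t c) :
    2 * (Finset.univ.filter fun x => x ∉ C ∧ (G.Adj s x ∨ G.Adj t x)).card <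
      (nonNeighbors G C s t).card := by
  have h1 := T.card_outside_le_right hcl hsp hqt
  have h2 := T.rev.card_outside_le_right hcl hsp hqt
  have h3 := T.card_right_add_card_left_le
  simp only [List.mem_reverse, List.toFinset_reverse] at h2
  rcases T.mem_iff.1 hc with rfl | h | rfl | h
  · exact absurd hsc G.irrefl
  · have h4 := T.rev.card_outside_lt_right hcl hsp hqt (List.mem_reverse.2 h) hsc htc
    simp only [List.mem_reverse, List.toFinset_reverse] at h4
    omega
  · exact absurd htc G.irrefl
  · have h4 := T.card_outside_lt_right hcl hsp hqt h hsc htc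
    omega

theorem one_le_card_outside (T : Theta G C s t Q₁ Q₂ π s₁ t₁ t₂ s₂ p q) (hsp : G.Adj s p) :
    1 ≤ (Finset.univ.filter fun x => x ∉ C ∧ (G.Adj s x ∨ G.Adj t x)).card :=
  Finset.card_pos.2 ⟨p, by simp [T.p_notMem, hsp]⟩

theorem degree_add_lt (T : Theta G C s t Q₁ Q₂ π s₁ t₁ t₂ s₂ p q) (hcl : ClawOAdj G)
    (hsp : G.Adj s p) (hqt : G.Adj q t) : G.degree s + G.degree t < Fintype.card V := by
  set g := Finset.univ.filter fun x => x ∉ C ∧ (G.Adj s x ∨ G.Adj t x) with hg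
  set D := Finset.univ.filter fun x => x ∈ C ∧ G.Adj s x ∧ G.Adj t x with hD
  set L := nonNeighbors G C s t with hL
  have h1 : 1 ≤ g.card := T.one_le_card_outside hsp
  have h2 : 2 * g.card ≤ L.card := T.two_mul_card_outside_le hcl hsp hqt
  have h3 : 2 * D.card ≤ L.card := T.two_mul_card_common_le hcl hsp hqt
  have h4 : g.card + D.card < L.card := by
    rcases D.eq_empty_or_nonempty with h | ⟨c, hc⟩
    · rw [h, Finset.card_empty]
      omega
    · simp only [hD, Finset.mem_filter, Finset.mem_univ, true_and] at hc
      have : 2 * g.card < L.card := T.two_mul_card_outside_lt hcl hsp hqt hc.1 hc.2.1 hc.2.2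
      omega
  have h5 : (G.neighborFinset s ∪ G.neighborFinset t).card + L.card ≤ Fintype.card V := by
    rw [← Finset.card_union_of_disjoint]
    · exact Finset.card_le_univ _
    · rw [Finset.disjoint_left]
      intro x hx hx'
      simp only [hL, nonNeighbors, Finset.mem_filter] at hx'
      simp only [Finset.mem_union, SimpleGraph.mem_neighborFinset] at hx
      exact hx'.2.2 hx
  have h6 : (G.neighborFinset s ∩ G.neighborFinset t).card ≤ g.card + D.card := by
    refine (Finset.card_le_card fun x hx => ?_).trans (Finset.card_union_le g D)
    simp only [Finset.mem_inter, SimpleGraph.mem_neighborFinset] at hx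
    simp only [hg, hD, Finset.mem_union, Finset.mem_filter, Finset.mem_univ, true_and]
    tauto
  have h7 := Finset.card_union_add_card_inter (G.neighborFinset s) (G.neighborFinset t)
  rw [SimpleGraph.card_neighborFinset_eq_degree, SimpleGraph.card_neighborFinset_eq_degree] at h7
  omega

theorem degree_add_outside_lt (T : Theta G C s t Q₁ Q₂ π s₁ t₁ t₂ s₂ p q) (hcl : ClawOAdj G)
    (hsp : G.Adj s p) (hqt : G.Adj q t) {o : V} (ho : o ∉ C)
    (h : 2 * (Finset.univ.filter fun x => x ∈ C ∧ x ≠ s ∧ G.Adj o x).card ≤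
      (Finset.univ.filter fun x => x ∈ C ∧ x ≠ s ∧ ¬ G.Adj s x).card) :
    G.degree s + G.degree o < Fintype.card V := by
  set g := Finset.univ.filter fun x => x ∉ C ∧ (G.Adj s x ∨ G.Adj t x) with hg
  set L := Finset.univ.filter fun x => x ∈ C ∧ x ≠ s ∧ ¬ G.Adj s x with hL
  set N := Finset.univ.filter fun x => x ∈ C ∧ x ≠ s ∧ G.Adj o x with hN
  have h2 : 2 * g.card ≤ L.card := by
    refine (T.two_mul_card_outside_le hcl hsp hqt).trans (Finset.card_le_card fun x hx => ?_)
    simp only [hL, nonNeighbors, Finset.mem_filter, Finset.mem_univ, true_and] at hx ⊢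
    tauto
  have h3 : (G.neighborFinset s).card + (L.card + 1) ≤ C.toFinset.card + g.card := by
    have hsL : s ∉ L := by simp [hL]
    rw [← Finset.card_insert_of_notMem hsL, ← Finset.card_union_of_disjoint]
    · refine (Finset.card_le_card fun x hx => ?_).trans (Finset.card_union_le C.toFinset g)
      have := T.s_mem
      simp only [hL, hg, Finset.mem_union, Finset.mem_filter, Finset.mem_univ, true_and,
        List.mem_toFinset, Finset.mem_insert, SimpleGraph.mem_neighborFinset] at hx ⊢
      by_cases hxC : x ∈ C
      · exact Or.inl hxC
      · rcases hx with hx | rfl | hx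
        · exact Or.inr ⟨hxC, Or.inl hx⟩
        · exact absurd this hxC
        · exact absurd hx.1 hxC
    · rw [Finset.disjoint_left]
      intro x hx hx'
      simp only [hL, Finset.mem_filter, Finset.mem_univ, true_and, Finset.mem_insert,
        SimpleGraph.mem_neighborFinset] at hx hx'
      rcases hx' with rfl | hx'
      · exact G.irrefl hx
      · exact hx'.2.2 hx
  have h4 : (G.neighborFinset o).card + C.toFinset.card ≤
      N.card + 1 + (Fintype.card V - 1) := by
    have hsub : G.neighborFinset o \ C.toFinset ∪ C.toFinset ⊆ Finset.univ.erase o := by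
      intro x hx
      simp only [Finset.mem_union, Finset.mem_sdiff, SimpleGraph.mem_neighborFinset,
        List.mem_toFinset] at hx
      rw [Finset.mem_erase]
      refine ⟨?_, Finset.mem_univ _⟩
      rintro rfl
      rcases hx with hx | hx
      · exact G.irrefl hx.1
      · exact ho hx
    have h5 := Finset.card_le_card hsub
    rw [Finset.card_union_of_disjoint Finset.sdiff_disjoint,
      Finset.card_erase_of_mem (Finset.mem_univ _), Finset.card_univ] at h5
    have h6 : (G.neighborFinset o ∩ C.toFinset).card ≤ N.card + 1 := by
      refine (Finset.card_le_card fun x hx => ?_).trans (Finset.card_insert_le s N)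
      simp only [Finset.mem_inter, SimpleGraph.mem_neighborFinset, List.mem_toFinset] at hx
      simp only [hN, Finset.mem_insert, Finset.mem_filter, Finset.mem_univ, true_and]
      tauto
    have h7 := Finset.card_sdiff_add_card_inter (G.neighborFinset o) C.toFinset
    omega
  have h8 : 0 < Fintype.card V := Fintype.card_pos_iff.2 ⟨s⟩
  rw [SimpleGraph.card_neighborFinset_eq_degree] at h3 h4
  omega

theorem degree_add_outside_lt_of_card_le_one (T : Theta G C s t Q₁ Q₂ π s₁ t₁ t₂ s₂ p q)
    (hcl : ClawOAdj G) (hsp : G.Adj s p) (hqt : G.Adj q t) {o : V} (ho : o ∉ C)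
    (h : ∀ x ∈ C, ∀ y ∈ C, G.Adj o x → G.Adj o y → x = y) :
    G.degree s + G.degree o < Fintype.card V := by
  refine T.degree_add_outside_lt hcl hsp hqt ho ?_
  have h1 : (Finset.univ.filter fun x => x ∈ C ∧ x ≠ s ∧ G.Adj o x).card ≤ 1 := by
    rw [Finset.card_le_one]
    intro x hx y hy
    simp only [Finset.mem_filter, Finset.mem_univ, true_and] at hx hy
    exact h x hx.1 y hy.1 hx.2.2 hy.2.2
  have h2 := T.one_le_card_outside hsp
  have h3 := T.two_mul_card_outside_le hcl hsp hqt
  have h4 : (nonNeighbors G C s t).card ≤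
      (Finset.univ.filter fun x => x ∈ C ∧ x ≠ s ∧ ¬ G.Adj s x).card := by
    refine Finset.card_le_card fun x hx => ?_
    simp only [nonNeighbors, Finset.mem_filter, Finset.mem_univ, true_and] at hx ⊢
    tauto
  omega

theorem degree_add_p_lt (T : Theta G C s t Q₁ Q₂ π s₁ t₁ t₂ s₂ p q)
    (hcl : ClawOAdj G) (hsp : G.Adj s p) (hqt : G.Adj q t) :
    G.degree s + G.degree p < Fintype.card V := by
  refine T.degree_add_outside_lt hcl hsp hqt T.p_notMem
    (T.max.two_mul_card_le T.p_notMem fun x hx => ?_)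
  simp only [Finset.mem_filter, Finset.mem_univ, true_and] at hx
  obtain ⟨P₁, P₂, u₁, x₁, x₂, u₂, T'⟩ := T.max.exists_theta T.s_mem hx.1 hx.2.1.symm
    (RPath.singleton _ p) (by simp) (by simpa using T.p_notMem) T.oadj_s (Or.inl hx.2.2)
  have h1 := T'.oadj_s₂_s₁ hcl hsp
  rw [T'.succ_t, T'.pred_t]
  simp only [Finset.mem_filter, Finset.mem_univ, true_and]
  exact ⟨hx.1, Or.inl hx.2.2.symm, T'.oadj_t₁_t₂ hcl hx.2.2, T'.t₁_ne_t₂,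
    ⟨T'.t₁_mem, T'.t₁_ne_s, fun h => T'.not_oadj_s_t₁ h1 (Or.inl h)⟩,
    ⟨T'.t₂_mem, T'.t₂_ne_s, fun h => T'.not_oadj_s_t₂ h1 (Or.inl h)⟩⟩

end Theta

end DegreeSum

section Ear

variable {V : Type*} {G : SimpleGraph V} {C : List V}

/-- The vertices of `π` form a path outside of `C` that connects two distinct vertices `s`, `t`
of `C`. -/
structure Ear (G : SimpleGraph V) (C : List V) (s t p q : V) (π : List V) : Prop where
  s_mem : s ∈ C
  t_mem : t ∈ C
  ne : s ≠ t
  path : RPath G.Adj p q π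
  nodup : π.Nodup
  notMem : ∀ x ∈ π, x ∉ C
  adj_s : G.Adj s p
  adj_t : G.Adj q t

theorem Ear.of_adj {s t o : V} (hs : s ∈ C) (ht : t ∈ C) (hst : s ≠ t) (ho : o ∉ C)
    (hos : G.Adj o s) (hot : G.Adj o t) : Ear G C s t o o [o] :=
  ⟨hs, ht, hst, RPath.singleton _ o, by simp, by simpa using ho, hos.symm, hot⟩

theorem SimpleGraph.Reachable.exists_rpath {P : V → Prop} {x y : {v | P v}}
    (h : (G.induce {v | P v}).Reachable x y) :
    ∃ π, RPath G.Adj x.1 y.1 π ∧ π.Nodup ∧ ∀ v ∈ π, P v := by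
  classical
  obtain ⟨w, hw⟩ := h.exists_isPath
  refine ⟨w.support.map Subtype.val, ⟨?_, ?_, ?_⟩,
    hw.support_nodup.map Subtype.val_injective, ?_⟩
  · rw [List.isChain_map]
    exact w.isChain_adj_support
  · rw [List.head?_map, List.head?_eq_some_head w.support_ne_nil, w.head_support]
    rfl
  · rw [List.getLast?_map, List.getLast?_eq_some_getLast w.support_ne_nil, w.getLast_support]
    rfl
  · intro v hv
    obtain ⟨z, -, rfl⟩ := List.mem_map.1 hv
    exact z.2

theorem exists_ear [Fintype V] (h : TwoConnected G) (hC : C.Nodup) (hlen : 2 ≤ C.length)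
    {o : V} (ho : o ∉ C) : ∃ s t p q π, Ear G C s t p q π := by
  have hother : ∀ v, ∃ c ∈ C, c ≠ v := by
    intro v
    by_contra! hv
    have := (hC.subperm (l₂ := [v]) fun x hx => by simp [hv x hx]).length_le
    simp at this
    omega
  have hstep : ∀ v ∈ C, ∃ s ∈ C, s ≠ v ∧ ∃ p : {x | x ∉ C},
      (G.induce {x | x ∉ C}).Reachable ⟨o, ho⟩ p ∧ G.Adj p s := by
    intro v hv
    obtain ⟨c, hc, hcv⟩ := hother v
    obtain ⟨w⟩ := (h.2 v).preconnected ⟨o, fun h => ho (h ▸ hv)⟩ ⟨c, hcv⟩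
    obtain ⟨d, -, ⟨h1, h2⟩, h3⟩ := w.exists_boundary_dart
      {x | ∃ hx : x.1 ∉ C, (G.induce {x | x ∉ C}).Reachable ⟨o, ho⟩ ⟨x.1, hx⟩}
      ⟨ho, SimpleGraph.Reachable.refl _⟩ fun ⟨h, _⟩ => h hc
    have hadj : G.Adj d.fst.1 d.snd.1 := d.adj
    by_cases h4 : d.snd.1 ∈ C
    · exact ⟨d.snd.1, h4, d.snd.2, ⟨d.fst.1, h1⟩, h2, hadj⟩
    · refine absurd ⟨h4, h2.trans (SimpleGraph.Adj.reachable ?_)⟩ h3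
      exact hadj
  obtain ⟨v, hv, -⟩ := hother o
  obtain ⟨s, hs, -, p, hp, hps⟩ := hstep v hv
  obtain ⟨t, ht, hts, q, hq, hqt⟩ := hstep s hs
  obtain ⟨π, h1, h2, h3⟩ := (hp.symm.trans hq).exists_rpath
  exact ⟨s, t, p, q, π, hs, ht, hts.symm, h1, h2, h3, hps.symm, hqt⟩

theorem exists_minimal_ear (h : ∃ s t p q π, Ear G C s t p q π) :
    ∃ s t p q π, Ear G C s t p q π ∧
      ∀ s' t' p' q' π', Ear G C s' t' p' q' π' → π.length ≤ π'.length := by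
  classical
  have hex : ∃ n s t p q π, Ear G C s t p q π ∧ π.length = n := by
    obtain ⟨s, t, p, q, π, h⟩ := h
    exact ⟨_, s, t, p, q, π, h, rfl⟩
  obtain ⟨s, t, p, q, π, h1, h2⟩ := Nat.find_spec hex
  refine ⟨s, t, p, q, π, h1, fun s' t' p' q' π' h' => ?_⟩
  rw [h2]
  exact Nat.find_min' hex ⟨s', t', p', q', π', h', rfl⟩

theorem TwoConnected.exists_adj [Fintype V] (h : TwoConnected G) : ∃ u v, G.Adj u v := by
  obtain ⟨v, a, b, hva, hvb, hab⟩ := Fintype.two_lt_card_iff.1 h.1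
  obtain ⟨w⟩ := (h.2 v).preconnected ⟨a, hva.symm⟩ ⟨b, hvb.symm⟩
  obtain ⟨d, -⟩ := w.exists_boundary_dart {⟨a, hva.symm⟩} rfl fun h =>
    hab (congrArg Subtype.val h).symm
  exact ⟨d.fst.1, d.snd.1, d.adj⟩

end Ear

section Assembly

variable {V : Type*} [Fintype V] {G : SimpleGraph V} [DecidableRel G.Adj] {C : List V}

variable (G) in
/-- Every induced path on six vertices has a vertex in its first half and a vertex in its second
half with degree sum at least the order of `G`. -/
def P6Heavy : Prop :=
  ∀ v : Fin 6 → V, IsInducedP6 G v →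
    ∃ i j : Fin 6, i.val ≤ 2 ∧ 3 ≤ j.val ∧ Fintype.card V ≤ G.degree (v i) + G.degree (v j)

theorem isInducedP6_of_adj_iff {V : Type*} {G : SimpleGraph V} {v : Fin 6 → V}
    (h : ∀ i j : Fin 6, G.Adj (v i) (v j) ↔ (i.val + 1 = j.val ∨ j.val + 1 = i.val)) :
    IsInducedP6 G v := by
  refine ⟨fun i j hij => ?_, h⟩
  have key : ∀ i j : Fin 6, (∀ k : Fin 6, (i.val + 1 = k.val ∨ k.val + 1 = i.val) ↔
      (j.val + 1 = k.val ∨ k.val + 1 = j.val)) → i = j := by decide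
  exact key i j fun k => by rw [← h, ← h, hij]

theorem P6Heavy.false_of_path (h : P6Heavy G) {x₁ x₂ x₃ x₄ x₅ x₆ : V} (h₁₂ : G.Adj x₁ x₂)
    (h₂₃ : G.Adj x₂ x₃) (h₃₄ : G.Adj x₃ x₄) (h₄₅ : G.Adj x₄ x₅) (h₅₆ : G.Adj x₅ x₆)
    (h₁₃ : ¬ G.Adj x₁ x₃) (h₄₆ : ¬ G.Adj x₄ x₆) (h₁₄ : ¬ OAdj G x₁ x₄) (h₁₅ : ¬ OAdj G x₁ x₅)
    (h₁₆ : ¬ OAdj G x₁ x₆) (h₂₄ : ¬ OAdj G x₂ x₄) (h₂₅ : ¬ OAdj G x₂ x₅) (h₂₆ : ¬ OAdj G x₂ x₆)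
    (hd : G.degree x₃ + G.degree x₄ < Fintype.card V) (h₃₅ : ¬ OAdj G x₃ x₅)
    (h₃₆ : ¬ OAdj G x₃ x₆) : False := by
  simp only [OAdj, not_or, not_le] at h₁₄ h₁₅ h₁₆ h₂₄ h₂₅ h₂₆ h₃₅ h₃₆
  have hP : IsInducedP6 G ![x₁, x₂, x₃, x₄, x₅, x₆] := by
    refine isInducedP6_of_adj_iff ?_
    intro i j
    fin_cases i <;> fin_cases j <;> simp_all [SimpleGraph.adj_comm]
  obtain ⟨i, j, hi, hj, hij⟩ := h _ hP
  obtain ⟨d, hd'⟩ : ∃ d : V → ℕ, ∀ x, G.degree x = d x := ⟨_, fun _ => rfl⟩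
  simp only [hd'] at *
  fin_cases i <;> fin_cases j <;> simp at hi hj hij <;> omega

theorem Ear.exists_runs {s t p q : V} {π : List V} (E : Ear G C s t p q π) (h : MaxCycle G C)
    (hcl : ClawOAdj G) : ∃ α a y β γ b z δ s₁ t₁ t₂ s₂,
      Runs G C s t α a y β γ b z δ π s₁ t₁ t₂ s₂ p q := by
  obtain ⟨Q₁, Q₂, s₁, t₁, t₂, s₂, T⟩ := h.exists_theta E.s_mem E.t_mem E.ne
    (E.path.mono OAdj.of_adj) E.nodup E.notMem (Or.inl E.adj_s) (Or.inl E.adj_t)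
  obtain ⟨α, a, y, β, γ, b, z, δ, S⟩ := T.exists_runs hcl E.adj_s E.adj_t
  exact ⟨α, a, y, β, γ, b, z, δ, s₁, t₁, t₂, s₂, S⟩

namespace Runs

variable [DecidableEq V] {s t s₁ t₁ t₂ s₂ p q a y b z : V} {α β γ δ π : List V}

theorem degree_add_lt (S : Runs G C s t α a y β γ b z δ π s₁ t₁ t₂ s₂ p q) :
    G.degree s + G.degree t < Fintype.card V := S.theta.degree_add_lt S.claw S.adj_p S.adj_q

theorem not_oadj_s_t (S : Runs G C s t α a y β γ b z δ π s₁ t₁ t₂ s₂ p q) (h : ¬ G.Adj s t) :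
    ¬ OAdj G s t := by
  have := S.degree_add_lt
  rintro (h1 | h1)
  · exact h h1
  · omega

theorem false_of_adj (S : Runs G C s t α a y β γ b z δ π s₁ t₁ t₂ s₂ p q) (hP : P6Heavy G)
    (h : G.Adj s t) : False :=
  hP.false_of_path S.path_y.2.symm S.adj_a.symm h S.adj_b S.swap.path_y.2
    (fun h => S.not_adj_y h.symm) S.not_adj_z S.not_oadj_y_t S.not_oadj_y_b S.not_oadj_y_z
    S.not_oadj_a_t S.not_oadj_a_b (fun h => S.swap.not_oadj_y_b (OAdj.symm _ _ h)) S.degree_add_lt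
    (fun h => S.swap.not_oadj_a_t (OAdj.symm _ _ h))
    (fun h => S.swap.not_oadj_y_t (OAdj.symm _ _ h))

theorem false_of_singleton (S : Runs G C s t α a y β γ b z δ [p] s₁ t₁ t₂ s₂ p q)
    (hP : P6Heavy G) : False := by
  obtain rfl : p = q := by simpa using S.theta.path.2.2
  by_cases h : G.Adj s t
  · exact S.false_of_adj hP h
  have hω : ∀ v ∈ [p], v ∉ C := S.theta.notMem
  exact hP.false_of_path S.path_y.2.symm S.adj_a.symm S.adj_p S.adj_q S.adj_b
    (fun h => S.not_adj_y h.symm)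
    (fun h => S.swap.not_oadj_p b (by simp) (Or.inl h.symm))
    (S.not_oadj_y_of_prefix (RPath.singleton _ p) (by simp) hω S.theta.oadj_s)
    S.not_oadj_y_t S.not_oadj_y_b
    (S.not_oadj_a_of_prefix (RPath.singleton _ p) (by simp) hω S.theta.oadj_s)
    S.not_oadj_a_t S.not_oadj_a_b (S.theta.degree_add_p_lt S.claw S.adj_p S.adj_q)
    (S.not_oadj_s_t h) (fun h => S.swap.not_oadj_a_t (OAdj.symm _ _ h))

theorem not_oadj_outside (S : Runs G C s t α a y β γ b z δ π s₁ t₁ t₂ s₂ p q)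
    (h1 : ∀ o ∉ C, ∀ u ∈ C, ∀ v ∈ C, G.Adj o u → G.Adj o v → u = v) {o : V} (ho : o ∉ C)
    (hso : ¬ G.Adj s o) : ¬ OAdj G s o := by
  have := S.theta.degree_add_outside_lt_of_card_le_one S.claw S.adj_p S.adj_q ho (h1 o ho)
  rintro (h | h)
  · exact hso h
  · omega

/-- The final contradiction for a connecting path with at least two vertices; `x` is its third
vertex, or `t` if there is none. -/
theorem false_of_cons_cons {u x : V} {ρ : List V}
    (S : Runs G C s t α a y β γ b z δ (p :: u :: ρ) s₁ t₁ t₂ s₂ p q) (hP : P6Heavy G)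
    (h1 : ∀ o ∉ C, ∀ c ∈ C, ∀ d ∈ C, G.Adj o c → G.Adj o d → c = d)
    (hpu : G.Adj p u) (hux : G.Adj u x) (hpx : ¬ G.Adj p x) (hyx : ¬ OAdj G y x)
    (hax : ¬ OAdj G a x) (hsu : ¬ G.Adj s u) (hsx : ¬ OAdj G s x) : False := by
  have hp := S.theta.p_notMem
  have hu : u ∉ C := S.theta.notMem u (by simp)
  have h2 : RPath (OAdj G) p u [p, u] := (RPath.singleton _ u).cons (OAdj.of_adj _ _ hpu)
  have h3 : ∀ v ∈ [p, u], v ∉ C := by simp [hp, hu]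
  have h4 : [p].Nodup ∧ [p, u].Nodup := by simp [hpu.ne]
  exact hP.false_of_path S.path_y.2.symm S.adj_a.symm S.adj_p hpu hux
    (fun h => S.not_adj_y h.symm) hpx
    (S.not_oadj_y_of_prefix (RPath.singleton _ p) h4.1 (by simpa using hp) S.theta.oadj_s)
    (S.not_oadj_y_of_prefix h2 h4.2 h3 S.theta.oadj_s) hyx
    (S.not_oadj_a_of_prefix (RPath.singleton _ p) h4.1 (by simpa using hp) S.theta.oadj_s)
    (S.not_oadj_a_of_prefix h2 h4.2 h3 S.theta.oadj_s) hax
    (S.theta.degree_add_outside_lt_of_card_le_one S.claw S.adj_p S.adj_q hp (h1 p hp))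
    (S.not_oadj_outside h1 hu hsu) hsx

end Runs

theorem MaxCycle.not_ear_of_p6Heavy [DecidableEq V] (h : MaxCycle G C) (hcl : ClawOAdj G)
    (hP : P6Heavy G) : ¬ ∃ s t p q π, Ear G C s t p q π := by
  intro hex
  obtain ⟨s, t, p, q, π, E, hmin⟩ := exists_minimal_ear hex
  obtain ⟨α, a, y, β, γ, b, z, δ, s₁, t₁, t₂, s₂, S⟩ := E.exists_runs h hcl
  match π with
  | [] => exact E.path.ne_nil rfl
  | [p'] =>
    obtain rfl := E.path.eq_of_cons
    exact S.false_of_singleton hP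
  | p' :: u :: ρ =>
    obtain rfl := E.path.eq_of_cons
    have h1 : ∀ o ∉ C, ∀ c ∈ C, ∀ d ∈ C, G.Adj o c → G.Adj o d → c = d := by
      intro o ho c hc d hd hoc hod
      by_contra hcd
      have := hmin _ _ _ _ _ (Ear.of_adj hc hd hcd ho hoc hod)
      simp at this
    have hp := S.theta.p_notMem
    have hu : u ∉ C := E.notMem u (by simp)
    obtain ⟨hpu, hrest⟩ := List.isChain_cons_cons.1 E.path.1
    have hlast := E.path.2.2
    rw [List.getLast?_cons_cons] at hlast
    match ρ with
    | [] =>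
      obtain rfl : u = q := by simpa using hlast
      have hsu : ¬ G.Adj s u := fun h =>
        E.ne (h1 u hu s E.s_mem t E.t_mem h.symm E.adj_t)
      have hpt : ¬ G.Adj p t := fun h =>
        E.ne (h1 p hp s E.s_mem t E.t_mem E.adj_s.symm h)
      have hst : ¬ G.Adj s t := by
        intro hst
        have T := S.theta
        rcases hcl s p s₁ t E.adj_s T.adj_s₁ hst (T.ne_p_of_mem T.s₁_mem) (T.ne_p_of_mem T.t_mem)
          (T.swap.t₂_ne_s) with h | h | h
        · exact T.not_oadj_p_s₁ h
        · exact S.swap.not_oadj_outside h1 hp (fun h => hpt h.symm) (OAdj.symm _ _ h)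
        · exact T.swap.not_oadj_s_t₂ (T.oadj_t₁_t₂ hcl E.adj_t) (OAdj.symm _ _ h)
      exact S.false_of_cons_cons hP h1 hpu E.adj_t hpt S.not_oadj_y_t S.not_oadj_a_t hsu
        (S.not_oadj_s_t hst)
    | x :: ρ =>
      have hx : x ∉ C := E.notMem x (by simp)
      obtain ⟨hux, hrest'⟩ := List.isChain_cons_cons.1 hrest
      have hlast' := hlast
      rw [List.getLast?_cons_cons] at hlast'
      have hn := E.nodup
      have hN := E.notMem
      have hsu : ¬ G.Adj s u := fun h => by
        have := hmin _ _ _ _ _ (⟨E.s_mem, E.t_mem, E.ne, ⟨hrest, rfl, hlast⟩, by grind,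
          by grind, h, E.adj_t⟩ : Ear G C s t u q (u :: x :: ρ))
        simp at this
      have hsx : ¬ G.Adj s x := fun h => by
        have := hmin _ _ _ _ _ (⟨E.s_mem, E.t_mem, E.ne, ⟨hrest', rfl, hlast'⟩, by grind,
          by grind, h, E.adj_t⟩ : Ear G C s t x q (x :: ρ))
        simp at this
      have hpx : ¬ G.Adj p x := fun h => by
        have := hmin _ _ _ _ _ (⟨E.s_mem, E.t_mem, E.ne,
          ⟨List.isChain_cons_cons.2 ⟨h, hrest'⟩, rfl, by rwa [List.getLast?_cons_cons]⟩, by grind,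
          by grind, E.adj_s, E.adj_t⟩ : Ear G C s t p q (p :: x :: ρ))
        simp at this
      have h2 : RPath (OAdj G) p x [p, u, x] :=
        ((RPath.singleton _ x).cons (OAdj.of_adj _ _ hux)).cons (OAdj.of_adj _ _ hpu)
      exact S.false_of_cons_cons hP h1 hpu hux hpx
        (S.not_oadj_y_of_prefix h2 (by grind) (by grind) S.theta.oadj_s)
        (S.not_oadj_a_of_prefix h2 (by grind) (by grind) S.theta.oadj_s) hsu
        (S.not_oadj_outside h1 hx hsx)

end Assembly

/-- If `G` is a 2-connected claw-o-heavy graph of order `n` such that for every induced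
path `v₁v₂v₃v₄v₅v₆` on 6 vertices there are `i ∈ {1,2,3}` and `j ∈ {4,5,6}` with
`d(vᵢ) + d(vⱼ) ≥ n`, then `G` is hamiltonian. -/
theorem stmt_0 {V : Type*} [Fintype V] [DecidableEq V] (G : SimpleGraph V) [DecidableRel G.Adj]
    (h2conn : TwoConnected G) (hclaw : ClawOHeavy G)
    (hP6 : ∀ v : Fin 6 → V, IsInducedP6 G v →
      ∃ i j : Fin 6, i.val ≤ 2 ∧ 3 ≤ j.val ∧
        Fintype.card V ≤ G.degree (v i) + G.degree (v j)) :
    G.IsHamiltonian := by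
  obtain ⟨u, v, huv⟩ := h2conn.exists_adj
  have : Nonempty V := ⟨u⟩
  have huv' : [u, v].Nodup ∧ RCycle (OAdj G) [u, v] :=
    ⟨by simp [huv.ne], u, v, (RPath.singleton _ v).cons (Or.inl huv), Or.inl huv.symm⟩
  obtain ⟨C, hC, hcyc, hmax⟩ := exists_maximum_cycle ⟨_, huv'⟩
  have hlen := hmax _ huv'.1 huv'.2
  refine isHamiltonian_of_cycle hC hcyc (le_antisymm hC.length_le_card ?_) h2conn.1
  by_contra! hlt
  obtain ⟨o, ho⟩ : ∃ o, o ∉ C := by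
    by_contra! hall
    have h1 : C.toFinset = Finset.univ := Finset.eq_univ_iff_forall.2 (by simpa using hall)
    rw [← List.toFinset_card_of_nodup hC, h1, Finset.card_univ] at hlt
    exact lt_irrefl _ hlt
  exact MaxCycle.not_ear_of_p6Heavy ⟨hC, hcyc, hmax⟩ hclaw.clawOAdj hP6
    (exists_ear h2conn hC hlen ho)
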